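/- arXiv:2311.05116 — 2 statements merged into one kernel-verified Lean document; each statement's English description precedes it below -/
import Mathlib

section
/- There exist absolute constants c₁, c₂ ≥ 1 with the following property. Let d ≥ 1 and n_1, …, n_d ≥ 2 be integers with N := ∏_{i=1}^d n_i ≥ 8, let r be an integer with 1 ≤ r ≤ min_i n_i, and let 0 < ε ≤ π/6. Let T ∈ ℝ^{n_1×⋯×n_d} be a random tensor whose entries are independent standard Gaussian random variables. Then ℙ( there exists a nonzero tensor T' of CP rank at most r with ∠(T, T') ≤ ε ) ≤ sin(2ε)^{N−1}·ε^{−(r·Σ_{i=1}^d n_i − 1)}·(c₁ d)^{r·Σ_{i=1}^d n_i}·r^{c₂ d² r²}/(√N·c₁^{d r²}), where ∠(T, T') ∈ [0, π] is the angle between T and T' with respect to the Frobenius inner product. -/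
open MeasureTheory ProbabilityTheory Real

/-- A tensor `T ∈ ℝ^{n₁ × ⋯ × n_d}` has CP rank at most `r` if it is a sum of `r`
rank-one (elementary) tensors. -/
def CPRankLE {d : ℕ} {n : Fin d → ℕ} (r : ℕ)
    (T : EuclideanSpace ℝ ((i : Fin d) → Fin (n i))) : Prop :=
  ∃ a : Fin r → (i : Fin d) → Fin (n i) → ℝ,
    ∀ k : (i : Fin d) → Fin (n i), T k = ∑ j : Fin r, ∏ i : Fin d, a j i (k i)

/-- The standard Gaussian measure on `EuclideanSpace ℝ ι` (i.i.d. standard Gaussian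
coordinates). -/
noncomputable def stdGaussian (ι : Type*) [Fintype ι] :
    Measure (EuclideanSpace ℝ ι) :=
  (Measure.pi fun _ : ι => gaussianReal 0 1).map
    (MeasurableEquiv.toLp 2 (ι → ℝ))

/-- A subset of a metric space whose `δ`-separated finite subsets have bounded cardinality has a
`δ`-net which is itself `δ`-separated. -/
lemma exists_separated_net {X : Type*} [PseudoMetricSpace X] (A : Set X) {δ : ℝ}
    (hδ : 0 < δ) (B : ℕ)
    (h : ∀ Z : Finset X, (Z : Set X) ⊆ A → (∀ x ∈ Z, ∀ y ∈ Z, x ≠ y → δ ≤ dist x y) → Z.card ≤ B) :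
    ∃ Z : Finset X, (Z : Set X) ⊆ A ∧ (∀ x ∈ Z, ∀ y ∈ Z, x ≠ y → δ ≤ dist x y) ∧
      ∀ x ∈ A, ∃ z ∈ Z, dist x z < δ := by
  classical
  let P : ℕ → Prop := fun m => ∃ Z : Finset X, (Z : Set X) ⊆ A ∧
    (∀ x ∈ Z, ∀ y ∈ Z, x ≠ y → δ ≤ dist x y) ∧ Z.card = m
  have hP0 : P 0 := ⟨∅, by simp, by simp, by simp⟩
  obtain ⟨Z, hZA, hZs, hZc⟩ : P (Nat.findGreatest P B) := Nat.findGreatest_spec (Nat.zero_le _) hP0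
  refine ⟨Z, hZA, hZs, fun x hx => ?_⟩
  by_contra! hcon
  have hxZ : x ∉ Z := fun hxZ => by
    have := hcon x hxZ
    rw [dist_self] at this
    linarith
  have hins : P (Z.card + 1) := by
    refine ⟨insert x Z, ?_, ?_, Finset.card_insert_of_notMem hxZ⟩
    · rw [Finset.coe_insert]
      exact Set.insert_subset hx hZA
    · intro a ha b hb hab
      rcases Finset.mem_insert.1 ha with ha' | ha' <;>
        rcases Finset.mem_insert.1 hb with hb' | hb'
      · exact absurd (ha'.trans hb'.symm) hab
      · rw [ha']
        exact hcon b hb'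
      · rw [hb', dist_comm]
        exact hcon a ha'
      · exact hZs a ha' b hb' hab
  have hle : Z.card + 1 ≤ B := by
    obtain ⟨Z', h1, h2, h3⟩ := hins
    rw [← h3]
    exact h Z' h1 h2
  have := Nat.le_findGreatest hle hins
  omega

/-- Volumetric bound for the cardinality of a separated subset of a ball. -/
lemma card_le_of_separated_of_norm_le {E : Type*} [NormedAddCommGroup E] [NormedSpace ℝ E]
    [FiniteDimensional ℝ E] {δ R : ℝ} (hδ : 0 < δ) (hR : 0 ≤ R) (Z : Finset E)
    (hZ : ∀ z ∈ Z, ‖z‖ ≤ R) (hs : ∀ x ∈ Z, ∀ y ∈ Z, x ≠ y → δ ≤ dist x y) :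
    (Z.card : ℝ) ≤ (1 + 2 * R / δ) ^ Module.finrank ℝ E := by
  borelize E
  let μ : Measure E := Measure.addHaar
  have hd2 : 0 < δ / 2 := by positivity
  set ρ : ℝ := R + δ / 2 with hρ
  have ρpos : 0 < ρ := by positivity
  set A := ⋃ z ∈ Z, Metric.ball (z : E) (δ / 2) with hA
  have D : Set.Pairwise (Z : Set E)
      (Function.onFun Disjoint fun z => Metric.ball (z : E) (δ / 2)) := by
    rintro c hc e he hce
    apply Metric.ball_disjoint_ball
    have := hs c hc e he hce
    linarith
  have A_subset : A ⊆ Metric.ball (0 : E) ρ := by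
    refine Set.iUnion₂_subset fun x hx => ?_
    apply Metric.ball_subset_ball'
    rw [dist_zero_right, hρ]
    linarith [hZ x hx]
  have I : (Z.card : ENNReal) * ENNReal.ofReal ((δ / 2) ^ Module.finrank ℝ E) *
      μ (Metric.ball 0 1) ≤
      ENNReal.ofReal (ρ ^ Module.finrank ℝ E) * μ (Metric.ball 0 1) :=
    calc
      (Z.card : ENNReal) * ENNReal.ofReal ((δ / 2) ^ Module.finrank ℝ E) * μ (Metric.ball 0 1)
        = μ A := by
        rw [hA, measure_biUnion_finset D fun c _ => measurableSet_ball]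
        simp only [μ.addHaar_ball_of_pos _ hd2, Finset.sum_const, nsmul_eq_mul, mul_assoc]
      _ ≤ μ (Metric.ball (0 : E) ρ) := measure_mono A_subset
      _ = _ := by simp only [μ.addHaar_ball_of_pos _ ρpos]
  have J : (Z.card : ENNReal) * ENNReal.ofReal ((δ / 2) ^ Module.finrank ℝ E) ≤
      ENNReal.ofReal (ρ ^ Module.finrank ℝ E) :=
    (ENNReal.mul_le_mul_iff_left (Metric.measure_ball_pos _ _ zero_lt_one).ne'
      measure_ball_lt_top.ne).1 I
  have K : (Z.card : ℝ) * (δ / 2) ^ Module.finrank ℝ E ≤ ρ ^ Module.finrank ℝ E := by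
    have := ENNReal.toReal_le_of_le_ofReal (by positivity) J
    rwa [ENNReal.toReal_mul, ENNReal.toReal_ofReal (by positivity), ENNReal.toReal_natCast] at this
  have e : (1 + 2 * R / δ) = ρ / (δ / 2) := by rw [hρ]; field_simp; ring
  rw [e, div_pow, le_div_iff₀ (by positivity)]
  exact K

/-- A bounded subset of a finite-dimensional normed space has a small net. -/
lemma exists_net_of_norm_le {E : Type*} [NormedAddCommGroup E] [NormedSpace ℝ E]
    [FiniteDimensional ℝ E] (A : Set E) {δ R : ℝ} (hδ : 0 < δ) (hR : 0 ≤ R)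
    (hA : ∀ z ∈ A, ‖z‖ ≤ R) :
    ∃ Z : Finset E, (Z : Set E) ⊆ A ∧ (Z.card : ℝ) ≤ (1 + 2 * R / δ) ^ Module.finrank ℝ E ∧
      ∀ x ∈ A, ∃ z ∈ Z, dist x z < δ := by
  obtain ⟨Z, h1, h2, h3⟩ := exists_separated_net A hδ ⌊(1 + 2 * R / δ) ^ Module.finrank ℝ E⌋₊
    fun Z hZ hs => Nat.le_floor <|
      card_le_of_separated_of_norm_le hδ hR Z (fun z hz => hA z (hZ hz)) hs
  exact ⟨Z, h1, card_le_of_separated_of_norm_le hδ hR Z (fun z hz => hA z (h1 hz)) h2, h3⟩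

section Frames

open scoped Matrix.Norms.L2Operator Matrix

lemma l2_opNorm_one_le (ι : Type*) [Fintype ι] [DecidableEq ι] :
    ‖(1 : Matrix ι ι ℝ)‖ ≤ 1 := by
  rw [← Matrix.diagonal_one, Matrix.l2_opNorm_diagonal]
  exact (pi_norm_le_iff_of_nonneg zero_le_one).2 fun i => by simp

lemma l2_opNorm_transpose {ι κ : Type*} [Fintype ι] [Fintype κ] [DecidableEq ι] [DecidableEq κ]
    (A : Matrix ι κ ℝ) : ‖Aᵀ‖ = ‖A‖ := by
  rw [← Matrix.conjTranspose_eq_transpose_of_trivial, Matrix.l2_opNorm_conjTranspose]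

lemma l2_opNorm_transpose_mul_self {ι κ : Type*} [Fintype ι] [Fintype κ]
    [DecidableEq ι] [DecidableEq κ]
    (A : Matrix ι κ ℝ) :
    ‖Aᵀ * A‖ = ‖A‖ * ‖A‖ := by
  rw [← Matrix.conjTranspose_eq_transpose_of_trivial, Matrix.l2_opNorm_conjTranspose_mul_self]

lemma l2_opNorm_le_one_of_transpose_mul_self {ι κ : Type*} [Fintype ι] [Fintype κ]
    [DecidableEq ι] [DecidableEq κ]
    {U : Matrix ι κ ℝ}     (hU : Uᵀ * U = 1) : ‖U‖ ≤ 1 := by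
  have h := l2_opNorm_transpose_mul_self U
  rw [hU] at h
  nlinarith [l2_opNorm_one_le κ, norm_nonneg U]

lemma l2_opNorm_le_one_of_symm_idem {ι : Type*} [Fintype ι] [DecidableEq ι]
    {P : Matrix ι ι ℝ} (hs : Pᵀ = P) (hi : P * P = P) : ‖P‖ ≤ 1 := by
  have h := l2_opNorm_transpose_mul_self P
  rw [hs, hi] at h
  nlinarith [norm_nonneg P]

lemma proj_mul_self {n r : ℕ} {U : Matrix (Fin n) (Fin r) ℝ} (hU : Uᵀ * U = 1) :
    U * Uᵀ * (U * Uᵀ) = U * Uᵀ := by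
  rw [Matrix.mul_assoc, ← Matrix.mul_assoc Uᵀ, hU, Matrix.one_mul]

lemma l2_opNorm_one_sub_proj_le {n r : ℕ} {U : Matrix (Fin n) (Fin r) ℝ}
    (hU : Uᵀ * U = 1) : ‖1 - U * Uᵀ‖ ≤ 1 :=
  l2_opNorm_le_one_of_symm_idem (by simp)
    (by simp [Matrix.mul_sub, Matrix.sub_mul, proj_mul_self hU])

/-- The matrices `H` with `Uᵀ * H = 0`. -/
def frameKer {n r : ℕ} (U : Matrix (Fin n) (Fin r) ℝ) : Submodule ℝ (Matrix (Fin n) (Fin r) ℝ) :=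
  LinearMap.ker (mulLeftLinearMap (Fin r) ℝ Uᵀ)

lemma mem_frameKer {n r : ℕ} {U H : Matrix (Fin n) (Fin r) ℝ} :
    H ∈ frameKer U ↔ Uᵀ * H = 0 := by
  simp [frameKer]

lemma finrank_frameKer {n r : ℕ} {U : Matrix (Fin n) (Fin r) ℝ} (hU : Uᵀ * U = 1) :
    Module.finrank ℝ (frameKer U) = r * (n - r) := by
  have hsurj : Function.Surjective (mulLeftLinearMap (Fin r) ℝ Uᵀ) := fun B =>
    ⟨U * B, by simp [← Matrix.mul_assoc, hU]⟩
  have h := LinearMap.finrank_range_add_finrank_ker (mulLeftLinearMap (Fin r) ℝ Uᵀ)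
  rw [LinearMap.range_eq_top.2 hsurj, finrank_top, Module.finrank_matrix,
    Module.finrank_matrix] at h
  simp only [Fintype.card_fin, Module.finrank_self, mul_one] at h
  rw [Nat.mul_sub, mul_comm r n]
  refine Nat.eq_sub_of_add_eq' ?_
  exact h

/-- A frame close to `U₀` is parametrised by the graph of a bounded map: its column space is that
of `U₀ + H` with `U₀ᵀ * H = 0`. -/
lemma exists_graph_of_close {n r : ℕ} {U₀ U : Matrix (Fin n) (Fin r) ℝ} (hU₀ : U₀ᵀ * U₀ = 1)
    (hU : Uᵀ * U = 1) (h : ‖U - U₀‖ < 1 / 2) :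
    ∃ H : Matrix (Fin n) (Fin r) ℝ, U₀ᵀ * H = 0 ∧ ‖H‖ ≤ 3 ∧
      (U₀ + H) * (U₀ᵀ * U) = U ∧ ∃ M : Matrix (Fin r) (Fin r) ℝ, U₀ + H = U * M := by
  have hU₀n := l2_opNorm_le_one_of_transpose_mul_self hU₀
  have hUn := l2_opNorm_le_one_of_transpose_mul_self hU
  set M := U₀ᵀ * U with hM
  have h1M : ‖1 - M‖ ≤ 1 / 2 := by
    have : 1 - M = U₀ᵀ * (U₀ - U) := by rw [Matrix.mul_sub, hU₀]
    rw [this]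
    calc ‖U₀ᵀ * (U₀ - U)‖ ≤ ‖U₀ᵀ‖ * ‖U₀ - U‖ := Matrix.l2_opNorm_mul _ _
      _ ≤ 1 * (1 / 2) := by
        rw [l2_opNorm_transpose, norm_sub_rev]
        gcongr
      _ = 1 / 2 := one_mul _
  have : CompleteSpace (Matrix (Fin r) (Fin r) ℝ) := FiniteDimensional.complete ℝ _
  have hunit : IsUnit M := by
    have := isUnit_one_sub_of_norm_lt_one (x := 1 - M) (by linarith)
    rwa [sub_sub_cancel] at this
  obtain ⟨u, hu⟩ := hunit
  set W : Matrix (Fin r) (Fin r) ℝ := (u⁻¹).val with hW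
  have hMW : M * W = 1 := by rw [← hu, hW]; exact u.mul_inv
  have hWM : W * M = 1 := by rw [← hu, hW]; exact u.inv_mul
  have hWn : ‖W‖ ≤ 2 := by
    have e : W = 1 + (1 - M) * W := by rw [sub_mul, hMW, one_mul]; abel
    have : ‖W‖ ≤ 1 + 1 / 2 * ‖W‖ := by
      calc ‖W‖ = ‖1 + (1 - M) * W‖ := by rw [← e]
        _ ≤ ‖(1 : Matrix (Fin r) (Fin r) ℝ)‖ + ‖(1 - M) * W‖ := norm_add_le _ _
        _ ≤ 1 + ‖1 - M‖ * ‖W‖ := add_le_add (l2_opNorm_one_le _) (norm_mul_le _ _)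
        _ ≤ _ := by gcongr
    linarith
  refine ⟨U * W - U₀, ?_, ?_, ?_, W, by abel⟩
  · rw [Matrix.mul_sub, ← Matrix.mul_assoc, ← hM, hMW, hU₀, sub_self]
  · calc ‖U * W - U₀‖ ≤ ‖U * W‖ + ‖U₀‖ := norm_sub_le _ _
      _ ≤ ‖U‖ * ‖W‖ + ‖U₀‖ := by gcongr; exact Matrix.l2_opNorm_mul _ _
      _ ≤ 1 * 2 + 1 := by gcongr
      _ = 3 := by norm_num
  · rw [add_sub_cancel, Matrix.mul_assoc, hWM, Matrix.mul_one]

/-- A net of the Grassmannian of `r`-dimensional subspaces of `ℝⁿ`, given by orthonormal frames. -/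
lemma exists_frame_net (n r : ℕ) {δ : ℝ} (hδ : 0 < δ) (hδ1 : δ ≤ 1) :
    ∃ Z : Finset (Matrix (Fin n) (Fin r) ℝ), (∀ U ∈ Z, Uᵀ * U = 1) ∧
      (Z.card : ℝ) ≤ 5 ^ (n * r) * (7 / δ) ^ (r * (n - r)) ∧
      ∀ U : Matrix (Fin n) (Fin r) ℝ, Uᵀ * U = 1 → ∃ V ∈ Z, ‖(1 - V * Vᵀ) * U‖ ≤ δ := by
  classical
  obtain ⟨Z₀, hZ₀, hZ₀c, hZ₀n⟩ := exists_net_of_norm_le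
    {U : Matrix (Fin n) (Fin r) ℝ | Uᵀ * U = 1} (δ := 1 / 2) (R := 1) (by norm_num) (by norm_num)
    fun U hU => l2_opNorm_le_one_of_transpose_mul_self hU
  rw [Module.finrank_matrix] at hZ₀c
  simp only [Fintype.card_fin, Module.finrank_self, mul_one] at hZ₀c
  have hlocal : ∀ U₀ : Matrix (Fin n) (Fin r) ℝ, U₀ᵀ * U₀ = 1 →
      ∃ Z : Finset (Matrix (Fin n) (Fin r) ℝ), (∀ U ∈ Z, Uᵀ * U = 1) ∧
      (Z.card : ℝ) ≤ (7 / δ) ^ (r * (n - r)) ∧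
      ∀ U : Matrix (Fin n) (Fin r) ℝ, Uᵀ * U = 1 → ‖U - U₀‖ < 1 / 2 →
        ∃ V ∈ Z, ‖(1 - V * Vᵀ) * U‖ ≤ δ := by
    intro U₀ hU₀
    let A : Set (frameKer U₀) := {H | ‖(H : Matrix (Fin n) (Fin r) ℝ)‖ ≤ 3 ∧
      ∃ U : Matrix (Fin n) (Fin r) ℝ, Uᵀ * U = 1 ∧ ∃ M : Matrix (Fin r) (Fin r) ℝ, U₀ + H.1 = U * M}
    obtain ⟨Z, hZA, hZc, hZn⟩ := exists_net_of_norm_le A (δ := δ) (R := 3) hδ (by norm_num)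
      fun H hH => hH.1
    rw [finrank_frameKer hU₀] at hZc
    have hch : ∀ H : frameKer U₀, ∃ U : Matrix (Fin n) (Fin r) ℝ, H ∈ Z →
        (Uᵀ * U = 1 ∧ ∃ M : Matrix (Fin r) (Fin r) ℝ, U₀ + H.1 = U * M) := fun H => by
      by_cases hH : H ∈ Z
      · obtain ⟨U, h⟩ := (hZA hH).2
        exact ⟨U, fun _ => h⟩
      · exact ⟨0, fun h => absurd h hH⟩
    choose F hF using hch
    refine ⟨Z.image F, ?_, ?_, ?_⟩
    · intro U hU
      obtain ⟨H, hH, rfl⟩ := Finset.mem_image.1 hU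
      exact (hF H hH).1
    · calc ((Z.image F).card : ℝ) ≤ Z.card := by exact_mod_cast Finset.card_image_le
        _ ≤ (1 + 2 * 3 / δ) ^ (r * (n - r)) := hZc
        _ ≤ (7 / δ) ^ (r * (n - r)) := by
          gcongr
          rw [le_div_iff₀ hδ, add_mul, div_mul_cancel₀ _ hδ.ne']
          linarith
    · intro U hU hUU₀
      obtain ⟨H, hH0, hH3, hHU, hHM⟩ := exists_graph_of_close hU₀ hU hUU₀
      obtain ⟨H', hH'Z, hHH'⟩ := hZn ⟨H, mem_frameKer.2 hH0⟩ ⟨hH3, U, hU, hHM⟩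
      obtain ⟨hV, M', hM'⟩ := hF H' hH'Z
      refine ⟨F H', Finset.mem_image_of_mem _ hH'Z, ?_⟩
      set V := F H'
      have hproj : (1 - V * Vᵀ) * (U₀ + (H' : Matrix (Fin n) (Fin r) ℝ)) = 0 := by
        rw [hM', ← Matrix.mul_assoc, Matrix.sub_mul, Matrix.mul_assoc V, hV]
        simp
      have e : (1 - V * Vᵀ) * U =
          (1 - V * Vᵀ) * (H - (H' : Matrix (Fin n) (Fin r) ℝ)) * (U₀ᵀ * U) := by
        have e1 : H - (H' : Matrix (Fin n) (Fin r) ℝ) = (U₀ + H) - (U₀ + H') := by abel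
        rw [e1, Matrix.mul_sub, hproj, sub_zero, Matrix.mul_assoc, hHU]
      have hdist : ‖H - (H' : Matrix (Fin n) (Fin r) ℝ)‖ < δ := by
        rw [dist_eq_norm] at hHH'
        exact hHH'
      rw [e]
      calc ‖(1 - V * Vᵀ) * (H - (H' : Matrix (Fin n) (Fin r) ℝ)) * (U₀ᵀ * U)‖
          ≤ ‖(1 - V * Vᵀ) * (H - (H' : Matrix (Fin n) (Fin r) ℝ))‖ * ‖U₀ᵀ * U‖ :=
            Matrix.l2_opNorm_mul _ _
        _ ≤ (‖1 - V * Vᵀ‖ * ‖H - (H' : Matrix (Fin n) (Fin r) ℝ)‖) * (‖U₀ᵀ‖ * ‖U‖) := by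
            gcongr <;> exact Matrix.l2_opNorm_mul _ _
        _ ≤ (1 * δ) * (1 * 1) := by
            rw [l2_opNorm_transpose]
            gcongr
            · exact l2_opNorm_one_sub_proj_le hV
            · exact l2_opNorm_le_one_of_transpose_mul_self hU₀
            · exact l2_opNorm_le_one_of_transpose_mul_self hU
        _ = δ := by ring
  choose! F hF1 hF2 hF3 using hlocal
  refine ⟨Z₀.biUnion F, ?_, ?_, ?_⟩
  · intro U hU
    obtain ⟨U₀, hU₀, hU⟩ := Finset.mem_biUnion.1 hU
    exact hF1 U₀ (hZ₀ hU₀) U hU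
  · calc ((Z₀.biUnion F).card : ℝ) ≤ ∑ U₀ ∈ Z₀, ((F U₀).card : ℝ) := by
          exact_mod_cast Finset.card_biUnion_le
      _ ≤ ∑ U₀ ∈ Z₀, (7 / δ) ^ (r * (n - r)) := Finset.sum_le_sum fun U₀ h => hF2 U₀ (hZ₀ h)
      _ = Z₀.card * (7 / δ) ^ (r * (n - r)) := by rw [Finset.sum_const, nsmul_eq_mul]
      _ ≤ 5 ^ (n * r) * (7 / δ) ^ (r * (n - r)) := by
        gcongr
        exact hZ₀c.trans_eq (by norm_num)
  · intro U hU
    obtain ⟨U₀, hU₀, hd⟩ := hZ₀n U hU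
    rw [dist_eq_norm] at hd
    obtain ⟨V, hV, h⟩ := hF3 U₀ (hZ₀ hU₀) U hU hd
    exact ⟨V, Finset.mem_biUnion.2 ⟨U₀, hU₀, hV⟩, h⟩

end Frames

section Kronecker

open scoped Matrix.Norms.L2Operator Matrix MatrixOrder

variable {d : ℕ} {m n p : Fin d → ℕ}

/-- The Kronecker product of a finite family of matrices. -/
def kron (A : ∀ i, Matrix (Fin (m i)) (Fin (n i)) ℝ) :
    Matrix (∀ i, Fin (m i)) (∀ i, Fin (n i)) ℝ :=
  Matrix.of fun k l => ∏ i, A i (k i) (l i)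

lemma kron_mul (A : ∀ i, Matrix (Fin (m i)) (Fin (n i)) ℝ)
    (B : ∀ i, Matrix (Fin (n i)) (Fin (p i)) ℝ) :
    kron A * kron B = kron fun i => A i * B i := by
  ext k l
  simp only [kron, Matrix.mul_apply, Matrix.of_apply, ← Finset.prod_mul_distrib]
  rw [Finset.prod_univ_sum, Fintype.piFinset_univ]

lemma kron_transpose (A : ∀ i, Matrix (Fin (m i)) (Fin (n i)) ℝ) :
    (kron A)ᵀ = kron fun i => (A i)ᵀ := by
  ext k l
  simp [kron]

lemma kron_one : kron (fun i => (1 : Matrix (Fin (n i)) (Fin (n i)) ℝ)) = 1 := by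
  ext k l
  simp only [kron, Matrix.of_apply, Matrix.one_apply]
  rw [Finset.prod_ite_zero]
  simp [funext_iff]

lemma kron_mulVec_cp {r : ℕ} (A : ∀ i, Matrix (Fin (m i)) (Fin (n i)) ℝ)
    (a : Fin r → ∀ i, Fin (n i) → ℝ) :
    (kron A *ᵥ fun l => ∑ j, ∏ i, a j i (l i)) = fun k => ∑ j, ∏ i, (A i *ᵥ a j i) (k i) := by
  ext k
  simp only [kron, Matrix.mulVec, dotProduct, Matrix.of_apply, Finset.mul_sum]
  rw [Finset.sum_comm]
  refine Finset.sum_congr rfl fun j _ => ?_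
  rw [Finset.prod_univ_sum, Fintype.piFinset_univ]
  simp only [Finset.prod_mul_distrib]

/-- The operator acting as `Q` on the `i`-th mode and as the identity on the others. -/
def kronAt (i : Fin d) (Q : Matrix (Fin (n i)) (Fin (n i)) ℝ) :
    Matrix (∀ i, Fin (n i)) (∀ i, Fin (n i)) ℝ :=
  kron (Function.update (fun j => (1 : Matrix (Fin (n j)) (Fin (n j)) ℝ)) i Q)

lemma kronAt_apply (i : Fin d) (Q : Matrix (Fin (n i)) (Fin (n i)) ℝ) (k l : ∀ i, Fin (n i)) :
    kronAt i Q k l = Q (k i) (l i) *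
      ∏ j ∈ Finset.univ.erase i, (1 : Matrix (Fin (n j)) (Fin (n j)) ℝ) (k j) (l j) := by
  rw [kronAt, kron, Matrix.of_apply, ← Finset.mul_prod_erase _ _ (Finset.mem_univ i)]
  congr 1
  · simp
  · refine Finset.prod_congr rfl fun j hj => ?_
    rw [Function.update_of_ne (Finset.ne_of_mem_erase hj)]

lemma kronAt_sub (i : Fin d) (Q R : Matrix (Fin (n i)) (Fin (n i)) ℝ) :
    kronAt i (Q - R) = kronAt i Q - kronAt i R := by
  ext k l
  simp only [kronAt_apply, Matrix.sub_apply]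
  ring

lemma kronAt_smul (i : Fin d) (c : ℝ) (Q : Matrix (Fin (n i)) (Fin (n i)) ℝ) :
    kronAt i (c • Q) = c • kronAt i Q := by
  ext k l
  simp only [kronAt_apply, Matrix.smul_apply, smul_eq_mul]
  ring

lemma kronAt_one (i : Fin d) : kronAt i (1 : Matrix (Fin (n i)) (Fin (n i)) ℝ) = 1 := by
  rw [kronAt, Function.update_eq_self i (fun j => (1 : Matrix (Fin (n j)) (Fin (n j)) ℝ)), kron_one]

lemma kronAt_mul (i : Fin d) (Q R : Matrix (Fin (n i)) (Fin (n i)) ℝ) :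
    kronAt i Q * kronAt i R = kronAt i (Q * R) := by
  rw [kronAt, kronAt, kronAt, kron_mul]
  congr 1
  ext1 j
  rcases eq_or_ne j i with rfl | h
  · simp
  · simp [h]

lemma kronAt_transpose (i : Fin d) (Q : Matrix (Fin (n i)) (Fin (n i)) ℝ) :
    (kronAt i Q)ᵀ = kronAt i Qᵀ := by
  rw [kronAt, kronAt, kron_transpose]
  congr 1
  ext1 j
  rcases eq_or_ne j i with rfl | h
  · simp
  · simp [h]

lemma norm_toLp_sq_eq_dotProduct {ι : Type*} [Fintype ι] (v : ι → ℝ) :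
    ‖WithLp.toLp 2 v‖ ^ 2 = v ⬝ᵥ v := by
  rw [EuclideanSpace.real_norm_sq_eq]
  simp [dotProduct, sq]

lemma norm_toLp_mulVec_sq {ι κ : Type*} [Fintype ι] [Fintype κ] (A : Matrix ι κ ℝ) (v : κ → ℝ) :
    ‖WithLp.toLp 2 (A *ᵥ v)‖ ^ 2 = v ⬝ᵥ ((Aᵀ * A) *ᵥ v) := by
  rw [norm_toLp_sq_eq_dotProduct, ← Matrix.mulVec_mulVec, Matrix.dotProduct_mulVec v,
    Matrix.vecMul_transpose]

/-- Acting on one mode of a tensor does not increase the operator norm. -/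
lemma norm_kronAt_mulVec_le (i : Fin d) (Q : Matrix (Fin (n i)) (Fin (n i)) ℝ)
    (v : (∀ i, Fin (n i)) → ℝ) :
    ‖WithLp.toLp 2 (kronAt i Q *ᵥ v)‖ ≤ ‖Q‖ * ‖WithLp.toLp 2 v‖ := by
  have hpsd : (‖Q‖ ^ 2 • (1 : Matrix (Fin (n i)) (Fin (n i)) ℝ) - Qᵀ * Q).PosSemidef := by
    refine Matrix.PosSemidef.of_dotProduct_mulVec_nonneg ?_ fun x => ?_
    · rw [Matrix.IsHermitian, Matrix.conjTranspose_eq_transpose_of_trivial]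
      simp [Matrix.transpose_sub]
    · rw [star_trivial, Matrix.sub_mulVec, dotProduct_sub, ← norm_toLp_mulVec_sq,
        Matrix.smul_mulVec, Matrix.one_mulVec, dotProduct_smul, ← norm_toLp_sq_eq_dotProduct,
        smul_eq_mul, ← mul_pow, sub_nonneg]
      gcongr
      exact Matrix.l2_opNorm_mulVec Q (WithLp.toLp 2 x)
  obtain ⟨R, hR⟩ := CStarAlgebra.nonneg_iff_eq_star_mul_self.1 hpsd.nonneg
  rw [Matrix.star_eq_conjTranspose, Matrix.conjTranspose_eq_transpose_of_trivial] at hR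
  have hR2 : ‖Q‖ ^ 2 • (1 : Matrix (∀ i, Fin (n i)) (∀ i, Fin (n i)) ℝ) -
      (kronAt i Q)ᵀ * kronAt i Q = (kronAt i R)ᵀ * kronAt i R := by
    rw [kronAt_transpose, kronAt_transpose, kronAt_mul, kronAt_mul, ← hR, kronAt_sub, kronAt_smul,
      kronAt_one]
  have h := norm_toLp_mulVec_sq (kronAt i R) v
  rw [← hR2, Matrix.sub_mulVec, dotProduct_sub, ← norm_toLp_mulVec_sq, Matrix.smul_mulVec,
    Matrix.one_mulVec, dotProduct_smul, ← norm_toLp_sq_eq_dotProduct, smul_eq_mul] at h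
  refine le_of_sq_le_sq ?_ (by positivity)
  rw [mul_pow]
  nlinarith [sq_nonneg ‖WithLp.toLp 2 (kronAt i R *ᵥ v)‖]

/-- Orthogonally projecting all modes of a tensor onto nearby subspaces moves it little. -/
lemma norm_sub_kron_proj_le {r : ℕ} {δ : ℝ} (U V : ∀ i, Matrix (Fin (n i)) (Fin r) ℝ)
    (hU : ∀ i, (U i)ᵀ * U i = 1) (hV : ∀ i, (V i)ᵀ * V i = 1)
    (hUV : ∀ i, ‖(1 - V i * (V i)ᵀ) * U i‖ ≤ δ) (x : (∀ i, Fin (n i)) → ℝ)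
    (hx : ∀ i, kronAt i (U i * (U i)ᵀ) *ᵥ x = x) :
    ‖WithLp.toLp 2 (x - kron (fun i => V i * (V i)ᵀ) *ᵥ x)‖ ≤ d * δ * ‖WithLp.toLp 2 x‖ := by
  classical
  let K : Finset (Fin d) → Matrix (∀ i, Fin (n i)) (∀ i, Fin (n i)) ℝ := fun s =>
    kron (s.piecewise (fun i => V i * (V i)ᵀ) fun i => 1)
  have hK1 : ∀ s, ‖K s‖ ≤ 1 := fun s => by
    refine l2_opNorm_le_one_of_symm_idem ?_ ?_
    · simp only [K, kron_transpose]
      congr 1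
      ext1 i
      by_cases h : i ∈ s <;> simp [h]
    · simp only [K, kron_mul]
      congr 1
      ext1 i
      by_cases h : i ∈ s <;> simp [h, proj_mul_self (hV i)]
  have hstep : ∀ i, ‖WithLp.toLp 2 (x - kronAt i (V i * (V i)ᵀ) *ᵥ x)‖ ≤
      δ * ‖WithLp.toLp 2 x‖ := fun i => by
    have e : x - kronAt i (V i * (V i)ᵀ) *ᵥ x =
        kronAt i ((1 - V i * (V i)ᵀ) * U i * (U i)ᵀ) *ᵥ x := by
      rw [Matrix.mul_assoc, ← kronAt_mul, ← Matrix.mulVec_mulVec, hx i, kronAt_sub, kronAt_one,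
        Matrix.sub_mulVec, Matrix.one_mulVec]
    rw [e]
    refine (norm_kronAt_mulVec_le _ _ _).trans ?_
    gcongr
    calc ‖(1 - V i * (V i)ᵀ) * U i * (U i)ᵀ‖ ≤ ‖(1 - V i * (V i)ᵀ) * U i‖ * ‖(U i)ᵀ‖ :=
          Matrix.l2_opNorm_mul _ _
      _ ≤ δ * 1 := by
        rw [l2_opNorm_transpose]
        gcongr
        · exact (norm_nonneg _).trans (hUV i)
        · exact hUV i
        · exact l2_opNorm_le_one_of_transpose_mul_self (hU i)
      _ = δ := mul_one _
  have hmain : ∀ s : Finset (Fin d),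
      ‖WithLp.toLp 2 (x - K s *ᵥ x)‖ ≤ s.card * (δ * ‖WithLp.toLp 2 x‖) := by
    intro s
    induction s using Finset.induction_on with
    | empty => simp [K, kron_one]
    | insert i s hi ih =>
      have hKi : K (insert i s) = K s * kronAt i (V i * (V i)ᵀ) := by
        simp only [K, kronAt, kron_mul]
        congr 1
        ext1 j
        rcases eq_or_ne j i with rfl | h
        · simp [hi]
        · simp [h, Finset.piecewise]
      have e : x - K (insert i s) *ᵥ x =
          (x - K s *ᵥ x) + K s *ᵥ (x - kronAt i (V i * (V i)ᵀ) *ᵥ x) := by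
        rw [hKi, Matrix.mulVec_sub, Matrix.mulVec_mulVec]
        abel
      rw [e, WithLp.toLp_add, Finset.card_insert_of_notMem hi]
      refine (norm_add_le _ _).trans ?_
      have h2 : ‖WithLp.toLp 2 (K s *ᵥ (x - kronAt i (V i * (V i)ᵀ) *ᵥ x))‖ ≤
          δ * ‖WithLp.toLp 2 x‖ := by
        refine (Matrix.l2_opNorm_mulVec (K s) (WithLp.toLp 2 _)).trans ?_
        refine (mul_le_of_le_one_left (norm_nonneg _) (hK1 s)).trans (hstep i)
      push_cast
      linarith
  have := hmain Finset.univ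
  simp only [K, Finset.piecewise_univ, Finset.card_univ, Fintype.card_fin] at this
  linarith

lemma norm_kron_mulVec_of_frames {r : ℕ} (V : ∀ i, Matrix (Fin (n i)) (Fin r) ℝ)
    (hV : ∀ i, (V i)ᵀ * V i = 1) (v : (Fin d → Fin r) → ℝ) :
    ‖WithLp.toLp 2 (kron (m := n) (n := fun _ => r) V *ᵥ v)‖ = ‖WithLp.toLp 2 v‖ := by
  refine (sq_eq_sq₀ (norm_nonneg _) (norm_nonneg _)).1 ?_
  rw [norm_toLp_mulVec_sq, kron_transpose, kron_mul, norm_toLp_sq_eq_dotProduct]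
  simp only [hV, kron_one (n := fun _ : Fin d => r), Matrix.one_mulVec]

lemma norm_kron_transpose_mulVec_le {r : ℕ} (V : ∀ i, Matrix (Fin (n i)) (Fin r) ℝ)
    (hV : ∀ i, (V i)ᵀ * V i = 1) (v : (∀ i, Fin (n i)) → ℝ) :
    ‖WithLp.toLp 2 (kron (m := fun _ => r) (n := n) (fun i => (V i)ᵀ) *ᵥ v)‖ ≤
      ‖WithLp.toLp 2 v‖ := by
  have h1 : ‖kron (m := n) (n := fun _ => r) V‖ ≤ 1 := by
    refine l2_opNorm_le_one_of_transpose_mul_self ?_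
    rw [kron_transpose, kron_mul]
    simp only [hV, kron_one (n := fun _ : Fin d => r)]
  have h2 := Matrix.l2_opNorm_mulVec (kron (m := fun _ => r) (n := n) (fun i => (V i)ᵀ))
    (WithLp.toLp 2 v)
  rw [← kron_transpose (m := n) (n := fun _ => r), l2_opNorm_transpose] at h2
  exact h2.trans (mul_le_of_le_one_left (norm_nonneg _) h1)

end Kronecker

section FactorFrames

open scoped Matrix RealInnerProductSpace

/-- Any `r ≤ n` vectors in `ℝⁿ` lie in the column space of an orthonormal `r`-frame. -/
lemma exists_frame_containing {n r : ℕ} (h : r ≤ n) (a : Fin r → Fin n → ℝ) :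
    ∃ U : Matrix (Fin n) (Fin r) ℝ, Uᵀ * U = 1 ∧ ∀ j, (U * Uᵀ) *ᵥ a j = a j := by
  let f : Fin n → EuclideanSpace ℝ (Fin n) := fun l =>
    if hl : (l : ℕ) < r then WithLp.toLp 2 (a ⟨l, hl⟩) else 0
  have hcard : Module.finrank ℝ (EuclideanSpace ℝ (Fin n)) = Fintype.card (Fin n) := by simp
  let b := InnerProductSpace.gramSchmidtOrthonormalBasis hcard f
  refine ⟨Matrix.of fun x j => b (Fin.castLE h j) x, ?_, fun j => ?_⟩
  · ext j k
    have := b.inner_eq_ite (Fin.castLE h k) (Fin.castLE h j)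
    rw [PiLp.inner_apply] at this
    simp only [Matrix.mul_apply, Matrix.transpose_apply, Matrix.of_apply, Matrix.one_apply]
    simp only [RCLike.inner_apply, conj_trivial] at this
    rw [this]
    simp [eq_comm]
  · have hfj : f (Fin.castLE h j) = WithLp.toLp 2 (a j) := by simp [f]
    have h1 := b.sum_repr' (f (Fin.castLE h j))
    have h2 : ∑ k : Fin r, ⟪b (Fin.castLE h k), f (Fin.castLE h j)⟫ • b (Fin.castLE h k) =
        ∑ i, ⟪b i, f (Fin.castLE h j)⟫ • b i := by
      refine Finset.sum_of_injOn (Fin.castLE h) (Fin.castLE_injective h).injOn (by simp) ?_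
        (fun _ _ => rfl)
      intro i _ hi
      have hi' : r ≤ (i : ℕ) := by
        by_contra hlt
        exact hi ⟨⟨i, by omega⟩, by simp, by ext; simp⟩
      have hlt : Fin.castLE h j < i := by
        rw [Fin.lt_def, Fin.val_castLE]
        omega
      rw [InnerProductSpace.gramSchmidtOrthonormalBasis_inv_triangular hcard f hlt, zero_smul]
    rw [h1, hfj] at h2
    rw [← Matrix.mulVec_mulVec]
    ext x
    have h3 := congrArg (fun v : EuclideanSpace ℝ (Fin n) => v x) h2
    simp only [WithLp.ofLp_sum, WithLp.ofLp_smul, Finset.sum_apply, Pi.smul_apply,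
      smul_eq_mul] at h3
    rw [← h3]
    simp only [Matrix.mulVec, dotProduct, Matrix.transpose_apply, Matrix.of_apply]
    refine Finset.sum_congr rfl fun k _ => ?_
    rw [PiLp.inner_apply]
    simp only [RCLike.inner_apply, conj_trivial]
    rw [mul_comm]
    congr 1
    exact Finset.sum_congr rfl fun _ _ => mul_comm _ _

end FactorFrames

section GaussianCap

open scoped RealInnerProductSpace

lemma gaussianReal_Ici_le {s : ℝ} (hs : 0 ≤ s) :
    gaussianReal 0 1 (Set.Ici s) ≤ ENNReal.ofReal (exp (-s ^ 2 / 2)) := by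
  have h := measure_ge_le_exp_mul_mgf (μ := gaussianReal 0 1) (X := id) s hs
    (integrable_exp_mul_gaussianReal s)
  rw [mgf_id_gaussianReal] at h
  rw [← ENNReal.ofReal_toReal (measure_ne_top (gaussianReal 0 1) (Set.Ici s))]
  refine ENNReal.ofReal_le_ofReal (h.trans_eq ?_)
  simp only [← exp_add]
  congr 1
  push_cast
  ring

lemma integral_exp_neg_mul_sq_gaussianReal {c : ℝ} (hc : 0 ≤ c) :
    ∫ x, exp (-(c / 2) * x ^ 2) ∂gaussianReal 0 1 = (√(1 + c))⁻¹ := by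
  rw [integral_gaussianReal_eq_integral_smul one_ne_zero]
  have h : ∀ x : ℝ, gaussianPDFReal 0 1 x • exp (-(c / 2) * x ^ 2) =
      (√(2 * π))⁻¹ * exp (-((1 + c) / 2) * x ^ 2) := by
    intro x
    rw [gaussianPDFReal_def, smul_eq_mul, mul_assoc, ← exp_add]
    simp only [NNReal.coe_one, mul_one]
    congr 2
    ring
  simp only [h]
  rw [integral_const_mul, integral_gaussian, ← sqrt_inv, ← sqrt_mul (by positivity), ← sqrt_inv]
  congr 1
  have : 1 + c ≠ 0 := by positivity
  have := pi_ne_zero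
  field_simp

lemma pi_gaussianReal_cone_le {ι : Type*} [Fintype ι] [DecidableEq ι] (i₀ : ι) {c : ℝ}
    (hc : 0 ≤ c) :
    (Measure.pi fun _ : ι => gaussianReal 0 1)
        {x | √(c * ∑ i ∈ Finset.univ.erase i₀, x i ^ 2) ≤ x i₀} ≤
      ENNReal.ofReal ((√(1 + c))⁻¹ ^ (Fintype.card ι - 1)) := by
  set S : (ι → ℝ) → ℝ := fun x => c * ∑ i ∈ Finset.univ.erase i₀, x i ^ 2
  have hS0 : ∀ x, 0 ≤ S x := fun x =>
    mul_nonneg hc (Finset.sum_nonneg fun i _ => sq_nonneg _)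
  have hSm : Measurable S := by fun_prop
  have hSu : ∀ x t, S (Function.update x i₀ t) = S x := by
    intro x t
    simp only [S]
    congr 1
    refine Finset.sum_congr rfl fun i hi => ?_
    rw [Function.update_of_ne (Finset.ne_of_mem_erase hi)]
  have hEm : MeasurableSet {x : ι → ℝ | √(S x) ≤ x i₀} :=
    measurableSet_le hSm.sqrt (measurable_pi_apply i₀)
  rw [← lintegral_indicator_one hEm]
  have hg : ∀ x : ι → ℝ, exp (-S x / 2) =
      ∏ i, (if i = i₀ then fun _ => (1 : ℝ) else fun t => exp (-(c / 2) * t ^ 2)) (x i) := by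
    intro x
    rw [← Finset.mul_prod_erase _ _ (Finset.mem_univ i₀)]
    simp only [if_true, one_mul]
    rw [Finset.prod_congr rfl (g := fun i => exp (-(c / 2) * x i ^ 2)), ← exp_sum]
    · simp only [S, ← Finset.mul_sum]
      congr 1
      ring
    · intro i hi
      rw [if_neg (Finset.ne_of_mem_erase hi)]
  calc ∫⁻ x, {x : ι → ℝ | √(S x) ≤ x i₀}.indicator 1 x ∂(Measure.pi fun _ => gaussianReal 0 1)
      ≤ ∫⁻ x, ENNReal.ofReal (exp (-S x / 2)) ∂(Measure.pi fun _ => gaussianReal 0 1) := by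
        refine lintegral_le_of_lmarginal_le {i₀} (measurable_one.indicator hEm) (by fun_prop) ?_
        intro x
        rw [lmarginal_singleton, lmarginal_singleton]
        simp only [hSu, lintegral_const, measure_univ, mul_one]
        have h1 : ∀ t : ℝ, {x : ι → ℝ | √(S x) ≤ x i₀}.indicator (1 : (ι → ℝ) → ENNReal)
            (Function.update x i₀ t) = (Set.Ici √(S x)).indicator 1 t := by
          intro t
          simp only [Set.indicator_apply, Set.mem_ofPred_eq, hSu, Function.update_self,
            Set.mem_Ici, Pi.one_apply]
        simp only [h1]
        rw [lintegral_indicator_one measurableSet_Ici]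
        refine (gaussianReal_Ici_le (sqrt_nonneg _)).trans_eq ?_
        rw [sq_sqrt (hS0 x)]
    _ = ENNReal.ofReal (∫ x, exp (-S x / 2) ∂(Measure.pi fun _ => gaussianReal 0 1)) := by
        rw [ofReal_integral_eq_lintegral_ofReal]
        · refine Integrable.of_bound (by fun_prop) 1 (Filter.Eventually.of_forall fun x => ?_)
          rw [norm_of_nonneg (exp_pos _).le, exp_le_one_iff]
          linarith [hS0 x]
        · exact Filter.Eventually.of_forall fun x => (exp_pos _).le
    _ = ENNReal.ofReal ((√(1 + c))⁻¹ ^ (Fintype.card ι - 1)) := by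
        simp only [hg]
        rw [integral_fintype_prod_eq_prod, ← Finset.mul_prod_erase _ _ (Finset.mem_univ i₀)]
        simp only [if_true, integral_const, probReal_univ, one_smul, one_mul]
        rw [Finset.prod_congr rfl (g := fun _ => (√(1 + c))⁻¹)]
        · simp [Finset.card_erase_of_mem]
        · intro i hi
          rw [if_neg (Finset.ne_of_mem_erase hi), integral_exp_neg_mul_sq_gaussianReal hc]

/-- The Gaussian measure of a circular cone of half-angle `θ < π / 2`. -/
lemma stdGaussian_angle_le {ι : Type*} [Fintype ι] (y : EuclideanSpace ℝ ι) {θ : ℝ}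
    (h0 : 0 < θ) (h1 : θ < π / 2) :
    _root_.stdGaussian ι {T | InnerProductGeometry.angle T y ≤ θ} ≤
      ENNReal.ofReal (sin θ ^ (Fintype.card ι - 1)) := by
  classical
  rcases eq_or_ne y 0 with rfl | hy
  · simp only [InnerProductGeometry.angle_zero_right, not_le.2 h1]
    exact measure_empty.trans_le zero_le
  have hne : Nonempty ι := by
    by_contra hemp
    rw [not_nonempty_iff] at hemp
    exact hy (Subsingleton.elim _ _)
  obtain ⟨i₀⟩ := hne
  have hsin : 0 < sin θ := sin_pos_of_pos_of_lt_pi h0 (by linarith [pi_pos])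
  have hcos : 0 < cos θ := cos_pos_of_mem_Ioo ⟨by linarith, h1⟩
  obtain ⟨b, hb⟩ := Orthonormal.exists_orthonormalBasis_extension_of_card_eq (𝕜 := ℝ)
    (E := EuclideanSpace ℝ ι) (ι := ι) (by simp) (v := fun _ => ‖y‖⁻¹ • y) (s := {i₀}) (by
      constructor
      · rintro ⟨i, hi⟩
        simp [Set.domRestrict, norm_smul, hy]
      · rintro ⟨i, hi⟩ ⟨j, hj⟩ hij
        simp only [Set.mem_singleton_iff] at hi hj
        exact absurd (by simp [hi, hj]) hij)
  have hbi : b i₀ = ‖y‖⁻¹ • y := hb i₀ rfl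
  have hlaw : _root_.stdGaussian ι =
      (Measure.pi fun _ : ι => gaussianReal 0 1).map (fun x => ∑ i, x i • b i) := by
    rw [← stdGaussian_eq_map_pi_orthonormalBasis b, ← map_pi_eq_stdGaussian]
    rfl
  have hmeas : Measurable fun x : ι → ℝ => ∑ i, x i • b i := by fun_prop
  set c : ℝ := cos θ ^ 2 / sin θ ^ 2 with hc
  have hc0 : 0 ≤ c := by positivity
  have hval : (√(1 + c))⁻¹ = sin θ := by
    have : 1 + c = (sin θ)⁻¹ ^ 2 := by
      rw [hc]
      field_simp
      linarith [sin_sq_add_cos_sq θ]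
    rw [this, sqrt_sq (by positivity), inv_inv]
  have hset : MeasurableSet {T : EuclideanSpace ℝ ι | cos θ * ‖T‖ ≤ ⟪T, b i₀⟫} :=
    measurableSet_le (by fun_prop) (by fun_prop)
  calc _root_.stdGaussian ι {T | InnerProductGeometry.angle T y ≤ θ}
      ≤ _root_.stdGaussian ι {T | cos θ * ‖T‖ ≤ ⟪T, b i₀⟫} := by
        refine measure_mono fun T hT => ?_
        simp only [Set.mem_ofPred_eq] at hT ⊢
        have h2 : cos θ ≤ cos (InnerProductGeometry.angle T y) :=
          cos_le_cos_of_nonneg_of_le_pi (InnerProductGeometry.angle_nonneg _ _)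
            (by linarith [pi_pos]) hT
        have h3 := InnerProductGeometry.cos_angle_mul_norm_mul_norm T y
        have hy' : 0 < ‖y‖ := norm_pos_iff.2 hy
        rw [hbi, inner_smul_right, ← h3]
        have h4 : ‖y‖⁻¹ * (cos (InnerProductGeometry.angle T y) * (‖T‖ * ‖y‖)) =
            cos (InnerProductGeometry.angle T y) * ‖T‖ := by
          field_simp
        rw [h4]
        exact mul_le_mul_of_nonneg_right h2 (norm_nonneg _)
    _ = (Measure.pi fun _ : ι => gaussianReal 0 1)
          ((fun x => ∑ i, x i • b i) ⁻¹' {T | cos θ * ‖T‖ ≤ ⟪T, b i₀⟫}) := by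
        rw [hlaw, Measure.map_apply hmeas hset]
    _ ≤ (Measure.pi fun _ : ι => gaussianReal 0 1)
          {x | √(c * ∑ i ∈ Finset.univ.erase i₀, x i ^ 2) ≤ x i₀} := by
        refine measure_mono fun x hx => ?_
        simp only [Set.mem_preimage, Set.mem_ofPred_eq] at hx ⊢
        have h2 : ⟪∑ i, x i • b i, b i₀⟫ = x i₀ := by
          simp [sum_inner, inner_smul_left, b.inner_eq_ite]
        have h3 : ‖∑ i, x i • b i‖ ^ 2 = ∑ i, x i ^ 2 := by
          rw [← real_inner_self_eq_norm_sq]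
          rw [b.orthonormal.inner_sum]
          simp [sq]
        rw [h2] at hx
        have hx0 : 0 ≤ x i₀ := (by positivity : 0 ≤ cos θ * ‖∑ i, x i • b i‖).trans hx
        rw [sqrt_le_left hx0, hc]
        have h4 : (cos θ * ‖∑ i, x i • b i‖) ^ 2 ≤ x i₀ ^ 2 :=
          pow_le_pow_left₀ (by positivity) hx 2
        rw [mul_pow, h3, ← Finset.add_sum_erase _ _ (Finset.mem_univ i₀)] at h4
        rw [div_mul_eq_mul_div, div_le_iff₀ (by positivity)]
        have h5 := sin_sq_add_cos_sq θ
        nlinarith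
    _ ≤ _ := by
        rw [← hval]
        exact pi_gaussianReal_cone_le i₀ hc0

end GaussianCap

section PolynomialMethod

open Polynomial in
/-- If the Chebyshev separation functions of a `δ`-separated subset of the unit ball all lie in a
space `W` of functions, then the dimension of `W` bounds the size of the set. -/
lemma card_le_finrank_of_chebyshev_mem {E : Type*} [NormedAddCommGroup E] {δ : ℝ} (hδ : 0 < δ)
    (hδ1 : δ ≤ 1) (Z : Finset E) (hZ : ∀ z ∈ Z, ‖z‖ ≤ 1)
    (hs : ∀ x ∈ Z, ∀ y ∈ Z, x ≠ y → δ ≤ dist x y) (k : ℕ)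
    (hk : (Z.card : ℝ) ≤ cosh (k * (δ / 2))) (W : Submodule ℝ (Z → ℝ))
    (hW : ∀ u : Z, (fun v : Z =>
      (Chebyshev.T ℝ k).eval (cosh (δ / 2) - ‖(u : E) - v‖ ^ 2 / 2)) ∈ W) :
    Z.card ≤ Module.finrank ℝ W := by
  classical
  let A : Matrix Z Z ℝ := Matrix.of fun u v =>
    (Chebyshev.T ℝ k).eval (cosh (δ / 2) - ‖(u : E) - v‖ ^ 2 / 2)
  have hcosh : cosh (δ / 2) ≤ 1 + δ ^ 2 / 4 := by
    have h1 := cosh_le_exp_half_sq (δ / 2)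
    have h2 : |(δ / 2) ^ 2 / 2| ≤ 1 := by
      rw [abs_of_nonneg (by positivity)]
      nlinarith
    have h3 := (abs_le.1 (abs_exp_sub_one_le h2)).2
    rw [abs_of_nonneg (by positivity)] at h3
    linarith
  have hdiag : ∀ u, A u u = cosh (k * (δ / 2)) := by
    intro u
    simp only [A, Matrix.of_apply, sub_self, norm_zero]
    simp
  have hoff : ∀ u v, u ≠ v → ‖A u v‖ ≤ 1 := by
    intro u v huv
    refine Chebyshev.abs_eval_T_real_le_one k (abs_le.2 ?_)
    have h1 : δ ≤ ‖(u : E) - v‖ := by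
      rw [← dist_eq_norm]
      exact hs u u.2 v v.2 fun h => huv (Subtype.ext h)
    have h2 : ‖(u : E) - v‖ ≤ 2 :=
      (norm_sub_le _ _).trans (by linarith [hZ u u.2, hZ v v.2])
    have h3 := one_le_cosh (δ / 2)
    constructor <;> nlinarith
  have hdet : A.det ≠ 0 := by
    refine det_ne_zero_of_sum_row_lt_diag fun u => ?_
    rw [hdiag, norm_of_nonneg (cosh_pos _).le]
    refine lt_of_lt_of_le ?_ hk
    calc ∑ v ∈ Finset.univ.erase u, ‖A u v‖ ≤ ∑ v ∈ Finset.univ.erase u, (1 : ℝ) :=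
          Finset.sum_le_sum fun v hv => hoff u v (Finset.ne_of_mem_erase hv).symm
      _ = ((Finset.univ.erase u).card : ℝ) := by simp
      _ < Z.card := by
          have := Finset.card_erase_lt_of_mem (Finset.mem_univ u)
          rw [Finset.card_univ, Fintype.card_coe] at this
          exact_mod_cast this
  have hli : LinearIndependent ℝ A.row :=
    Matrix.linearIndependent_rows_iff_isUnit.2
      ((Matrix.isUnit_iff_isUnit_det A).2 (isUnit_iff_ne_zero.2 hdet))
  have hli' : LinearIndependent ℝ (fun u => (⟨A.row u, hW u⟩ : W)) :=
    LinearIndependent.of_comp W.subtype hli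
  simpa using hli'.fintype_card_le_finrank

variable {Ω : Type*} {d r : ℕ}

/-- Exponents of monomials in the factor entries of a CP decomposition, of degree at most `L` in
every entry, and with equal degrees in the `i₀`-th and the `i₁`-th factor of each summand. -/
def balancedExp (d r : ℕ) (i₀ i₁ : Fin d) (L : ℕ) : Set (Fin r → Fin d → Fin r → ℕ) :=
  {e | (∀ j i x, e j i x ≤ L) ∧ ∀ j, ∑ x, e j i₀ x = ∑ x, e j i₁ x}

/-- The monomial with exponent `e`, as a function on a set of CP decompositions. -/
def cpMonomial (a : Ω → Fin r → Fin d → Fin r → ℝ) (e : Fin r → Fin d → Fin r → ℕ) : Ω → ℝ :=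
  fun v => ∏ j, ∏ i, ∏ x, a v j i x ^ e j i x

/-- The span of the balanced monomials of degree at most `L` in every entry. -/
def balancedSpan (a : Ω → Fin r → Fin d → Fin r → ℝ) (i₀ i₁ : Fin d) (L : ℕ) :
    Submodule ℝ (Ω → ℝ) :=
  Submodule.span ℝ (cpMonomial a '' balancedExp d r i₀ i₁ L)

lemma balancedExp_finite (i₀ i₁ : Fin d) (L : ℕ) : (balancedExp d r i₀ i₁ L).Finite := by
  refine (Set.finite_Iic (fun (_ : Fin r) (_ : Fin d) (_ : Fin r) => L)).subset ?_
  intro e he j i x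
  exact he.1 j i x

lemma ncard_balancedExp_le (hr : 0 < r) {i₀ i₁ : Fin d} (h : i₀ ≠ i₁) (L : ℕ) :
    (balancedExp d r i₀ i₁ L).ncard ≤ (L + 1) ^ (d * r ^ 2 - r) := by
  classical
  let x₀ : Fin r := ⟨0, hr⟩
  let p : Fin r × Fin d × Fin r → Prop := fun q => ¬ (q.2.1 = i₁ ∧ q.2.2 = x₀)
  let F : (Fin r → Fin d → Fin r → ℕ) → ({q // p q} → ℕ) := fun e q => e q.1.1 q.1.2.1 q.1.2.2
  have hinj : Set.InjOn F (balancedExp d r i₀ i₁ L) := by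
    intro e he e' he' hee
    have hp : ∀ j i x, ¬ (i = i₁ ∧ x = x₀) → e j i x = e' j i x := fun j i x hq =>
      congrFun hee ⟨(j, i, x), hq⟩
    have h0 : ∀ j, e j i₁ x₀ = e' j i₁ x₀ := by
      intro j
      have h1 := he.2 j
      have h2 := he'.2 j
      rw [Finset.sum_congr rfl fun x _ => hp j i₀ x fun hq => h hq.1, h2,
        ← Finset.add_sum_erase _ _ (Finset.mem_univ x₀),
        ← Finset.add_sum_erase _ (fun x => e j i₁ x) (Finset.mem_univ x₀),
        Finset.sum_congr rfl fun x hx => hp j i₁ x fun hq => Finset.ne_of_mem_erase hx hq.2] at h1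
      exact (Nat.add_right_cancel h1).symm
    funext j i x
    by_cases hq : i = i₁ ∧ x = x₀
    · rw [hq.1, hq.2, h0]
    · exact hp j i x hq
  have hmaps : ∀ e ∈ balancedExp d r i₀ i₁ L,
      F e ∈ (↑(Fintype.piFinset fun _ : {q // p q} => Finset.range (L + 1)) :
        Set ({q // p q} → ℕ)) := by
    intro e he
    simp only [Finset.mem_coe, Fintype.mem_piFinset, Finset.mem_range]
    exact fun q => Nat.lt_succ_of_le (he.1 _ _ _)
  have hcard := Set.ncard_le_ncard_of_injOn F hmaps hinj (Finset.finite_toSet _)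
  rw [Set.ncard_coe_finset, Fintype.card_piFinset] at hcard
  refine hcard.trans_eq ?_
  simp only [Finset.card_range, Finset.prod_const, Finset.card_univ]
  congr 1
  rw [Fintype.card_subtype_compl]
  have hq : Fintype.card {q : Fin r × Fin d × Fin r // q.2.1 = i₁ ∧ q.2.2 = x₀} = r := by
    rw [Fintype.card_subtype]
    have : (Finset.univ.filter fun q : Fin r × Fin d × Fin r => q.2.1 = i₁ ∧ q.2.2 = x₀) =
        Finset.univ.image fun j : Fin r => (j, i₁, x₀) := by
      ext ⟨j, i, x⟩
      simp [eq_comm]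
    rw [this, Finset.card_image_of_injective _ fun j j' hj => by simpa using hj]
    simp
  rw [hq]
  simp only [Fintype.card_prod, Fintype.card_fin]
  congr 1
  ring

lemma finrank_balancedSpan_le (a : Ω → Fin r → Fin d → Fin r → ℝ) (hr : 0 < r) {i₀ i₁ : Fin d}
    (h : i₀ ≠ i₁) (L : ℕ) :
    Module.finrank ℝ (balancedSpan a i₀ i₁ L) ≤ (L + 1) ^ (d * r ^ 2 - r) := by
  have hfin := (balancedExp_finite (r := r) i₀ i₁ L)
  have := (hfin.image (cpMonomial a)).fintype
  refine (finrank_span_le_card _).trans ?_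
  rw [← Set.ncard_eq_toFinset_card']
  exact (Set.ncard_image_le hfin).trans (ncard_balancedExp_le hr h L)

lemma balancedSpan_mono (a : Ω → Fin r → Fin d → Fin r → ℝ) (i₀ i₁ : Fin d) :
    Monotone (balancedSpan a i₀ i₁) := fun _ _ h =>
  Submodule.span_mono (Set.image_mono fun _ he => ⟨fun j i x => (he.1 j i x).trans h, he.2⟩)

lemma mul_mem_balancedSpan (a : Ω → Fin r → Fin d → Fin r → ℝ) (i₀ i₁ : Fin d) {L L' : ℕ}
    {f g : Ω → ℝ} (hf : f ∈ balancedSpan a i₀ i₁ L) (hg : g ∈ balancedSpan a i₀ i₁ L') :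
    f * g ∈ balancedSpan a i₀ i₁ (L + L') := by
  have h := Submodule.mul_mem_mul hf hg
  rw [balancedSpan, balancedSpan, Submodule.span_mul_span] at h
  refine Submodule.span_mono ?_ h
  rintro _ ⟨_, ⟨e, he, rfl⟩, _, ⟨e', he', rfl⟩, rfl⟩
  refine ⟨e + e', ⟨fun j i x => add_le_add (he.1 j i x) (he'.1 j i x), fun j => ?_⟩, ?_⟩
  · simp [Finset.sum_add_distrib, he.2 j, he'.2 j]
  · ext v
    simp [cpMonomial, pow_add, Finset.prod_mul_distrib]

lemma one_mem_balancedSpan (a : Ω → Fin r → Fin d → Fin r → ℝ) (i₀ i₁ : Fin d) (L : ℕ) :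
    (1 : Ω → ℝ) ∈ balancedSpan a i₀ i₁ L := by
  refine Submodule.subset_span ⟨0, ⟨by simp, by simp⟩, ?_⟩
  ext v
  simp [cpMonomial]

lemma const_mem_balancedSpan (a : Ω → Fin r → Fin d → Fin r → ℝ) (i₀ i₁ : Fin d) (L : ℕ)
    (c : ℝ) : (fun _ => c : Ω → ℝ) ∈ balancedSpan a i₀ i₁ L := by
  convert Submodule.smul_mem _ c (one_mem_balancedSpan a i₀ i₁ L) using 1
  ext v
  simp

lemma pow_mem_balancedSpan (a : Ω → Fin r → Fin d → Fin r → ℝ) (i₀ i₁ : Fin d) {L : ℕ}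
    {f : Ω → ℝ} (hf : f ∈ balancedSpan a i₀ i₁ L) (k : ℕ) :
    f ^ k ∈ balancedSpan a i₀ i₁ (k * L) := by
  induction k with
  | zero => simpa using one_mem_balancedSpan a i₀ i₁ 0
  | succ k ih =>
    rw [pow_succ, Nat.succ_mul]
    exact mul_mem_balancedSpan a i₀ i₁ ih hf

open Polynomial in
lemma polynomial_eval_mem_balancedSpan (a : Ω → Fin r → Fin d → Fin r → ℝ) (i₀ i₁ : Fin d)
    {L k : ℕ} {f : Ω → ℝ} (hf : f ∈ balancedSpan a i₀ i₁ L) (q : ℝ[X]) (hq : q.natDegree ≤ k) :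
    (fun v => q.eval (f v)) ∈ balancedSpan a i₀ i₁ (k * L) := by
  have h : (fun v => q.eval (f v)) = ∑ m ∈ Finset.range (q.natDegree + 1), q.coeff m • f ^ m := by
    ext v
    simp [Polynomial.eval_eq_sum_range]
  rw [h]
  refine Submodule.sum_mem _ fun m hm => Submodule.smul_mem _ _ ?_
  refine balancedSpan_mono a i₀ i₁ (Nat.mul_le_mul_right L ?_) (pow_mem_balancedSpan a i₀ i₁ hf m)
  exact (Nat.lt_succ_iff.1 (Finset.mem_range.1 hm)).trans hq

lemma cp_entry_mem_balancedSpan (a : Ω → Fin r → Fin d → Fin r → ℝ) (i₀ i₁ : Fin d)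
    (x : Fin d → Fin r) :
    (fun v => ∑ j, ∏ i, a v j i (x i)) ∈ balancedSpan a i₀ i₁ 1 := by
  have h : (fun v => ∑ j, ∏ i, a v j i (x i)) =
      ∑ j, cpMonomial a fun j' i y => if j' = j ∧ y = x i then 1 else 0 := by
    ext v
    rw [Finset.sum_apply]
    refine Finset.sum_congr rfl fun j _ => ?_
    rw [cpMonomial, Finset.prod_eq_single j]
    · refine Finset.prod_congr rfl fun i _ => ?_
      rw [Finset.prod_eq_single (x i)]
      · simp
      · intro y _ hy
        simp [hy]
      · simp
    · intro j' _ hj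
      simp [hj]
    · simp
  rw [h]
  refine Submodule.sum_mem _ fun j _ => Submodule.subset_span ⟨_, ⟨?_, ?_⟩, rfl⟩
  · intro j' i y
    split_ifs <;> simp
  · intro j'
    by_cases hj : j' = j <;> simp [hj]

end PolynomialMethod

section CoreNet

open Polynomial in
/-- Cardinality of separated sets of tensors of format `r × ⋯ × r` and CP rank at most `r`, in
terms of the degree of a sufficiently large Chebyshev polynomial. -/
lemma card_le_of_separated_of_cpRank {d r : ℕ} (hd : 2 ≤ d) (hr : 0 < r) {δ : ℝ} (hδ : 0 < δ)
    (hδ1 : δ ≤ 1) (Z : Finset (EuclideanSpace ℝ (Fin d → Fin r)))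
    (hZ : ∀ z ∈ Z, ‖z‖ ≤ 1) (hs : ∀ x ∈ Z, ∀ y ∈ Z, x ≠ y → δ ≤ dist x y)
    (hcp : ∀ z ∈ Z, CPRankLE (n := fun _ : Fin d => r) r z) (k : ℕ)
    (hk : (Z.card : ℝ) ≤ cosh (k * (δ / 2))) :
    Z.card ≤ (2 * k + 1) ^ (d * r ^ 2 - r) := by
  choose a ha using fun z : Z => hcp z z.2
  let i₀ : Fin d := ⟨0, by omega⟩
  let i₁ : Fin d := ⟨1, by omega⟩
  have hi : i₀ ≠ i₁ := by simp [i₀, i₁]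
  rw [mul_comm 2 k]
  refine le_trans ?_ (finrank_balancedSpan_le a hr hi (k * 2))
  refine card_le_finrank_of_chebyshev_mem hδ hδ1 Z hZ hs k hk _ fun u => ?_
  refine polynomial_eval_mem_balancedSpan a i₀ i₁ ?_ _ (by simp [Chebyshev.natDegree_T])
  have hnorm : (fun v : Z => cosh (δ / 2) - ‖(u : EuclideanSpace ℝ (Fin d → Fin r)) - v‖ ^ 2 / 2) =
      (fun _ => cosh (δ / 2)) - (1 / 2 : ℝ) • ∑ x : Fin d → Fin r,
        ((fun _ => u.1 x) - fun v : Z => ∑ j, ∏ i, a v j i (x i)) ^ 2 := by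
    ext v
    simp only [EuclideanSpace.real_norm_sq_eq, Pi.sub_apply, Pi.smul_apply, Finset.sum_apply,
      Pi.pow_apply, smul_eq_mul, PiLp.sub_apply]
    rw [Finset.sum_congr rfl fun x _ => by rw [ha v x]]
    ring
  rw [hnorm]
  refine Submodule.sub_mem _ (const_mem_balancedSpan a i₀ i₁ 2 _) (Submodule.smul_mem _ _
    (Submodule.sum_mem _ fun x _ => ?_))
  exact pow_mem_balancedSpan a i₀ i₁ (Submodule.sub_mem _ (const_mem_balancedSpan a i₀ i₁ 1 _)
    (cp_entry_mem_balancedSpan a i₀ i₁ x)) 2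

lemma pow_le_pow_mul_exp {t : ℝ} (ht : 0 ≤ t) (p : ℕ) : t ^ p ≤ (p : ℝ) ^ p * exp t := by
  rcases Nat.eq_zero_or_pos p with rfl | hp
  · simpa using one_le_exp ht
  have hp' : (0 : ℝ) < p := by exact_mod_cast hp
  have h1 : t / p ≤ exp (t / p) := by linarith [add_one_le_exp (t / p)]
  have h2 : (t / p) ^ p ≤ exp (t / p) ^ p := pow_le_pow_left₀ (by positivity) h1 p
  rw [← exp_nat_mul, mul_div_cancel₀ _ hp'.ne', div_pow, div_le_iff₀ (by positivity)] at h2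
  linarith

lemma seven_mul_le_pow {d r : ℕ} (hd : 2 ≤ d) (hr : 2 ≤ r) :
    7 * r ^ d * (d * r ^ 2) ≤ r ^ (5 * d) := by
  have h1 : d ≤ r ^ d := (Nat.lt_pow_self (by omega)).le
  have h2 : r ^ 2 ≤ r ^ d := Nat.pow_le_pow_right (by omega) hd
  have h3 : 7 ≤ r ^ (2 * d) :=
    calc 7 ≤ 2 ^ 4 := by norm_num
      _ ≤ 2 ^ (2 * d) := Nat.pow_le_pow_right (by norm_num) (by omega)
      _ ≤ r ^ (2 * d) := Nat.pow_le_pow_left hr _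
  calc 7 * r ^ d * (d * r ^ 2) ≤ r ^ (2 * d) * r ^ d * (r ^ d * r ^ d) := by gcongr
    _ = r ^ (5 * d) := by ring

lemma card_le_of_separated_of_cpRank_of_two_le {d r : ℕ} (hd : 2 ≤ d) (hr : 2 ≤ r) {δ : ℝ}
    (hδ : 0 < δ) (hδ1 : δ ≤ 1) (Z : Finset (EuclideanSpace ℝ (Fin d → Fin r)))
    (hZ : ∀ z ∈ Z, ‖z‖ ≤ 1) (hs : ∀ x ∈ Z, ∀ y ∈ Z, x ≠ y → δ ≤ dist x y)
    (hcp : ∀ z ∈ Z, CPRankLE (n := fun _ : Fin d => r) r z) :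
    (Z.card : ℝ) ≤ (r : ℝ) ^ (5 * d ^ 2 * r ^ 2) * (1 / δ) ^ (d * r ^ 2 - 1) := by
  rcases Z.card.eq_zero_or_pos with h0 | hpos
  · rw [h0, Nat.cast_zero]
    positivity
  set R : ℝ := (r : ℝ) ^ d with hR
  have hR1 : 1 ≤ R := one_le_pow₀ (by exact_mod_cast (by omega : 1 ≤ r))
  set ℓ : ℝ := log (6 / δ) with hℓ
  have h6 : 6 ≤ 6 / δ := by
    rw [le_div_iff₀ hδ]
    linarith
  have hℓ1 : 1 ≤ ℓ := by
    rw [hℓ, le_log_iff_exp_le (by positivity)]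
    linarith [exp_one_lt_three]
  have hM : (Z.card : ℝ) ≤ (3 / δ) ^ (r ^ d) := by
    have := card_le_of_separated_of_norm_le hδ zero_le_one Z hZ hs
    simp only [finrank_euclideanSpace, Fintype.card_pi, Fintype.card_fin, Finset.prod_const,
      Finset.card_univ] at this
    refine this.trans (pow_le_pow_left₀ (by positivity) ?_ _)
    rw [le_div_iff₀ hδ, add_mul, div_mul_cancel₀ _ hδ.ne']
    linarith
  have hM0 : (0 : ℝ) < Z.card := by exact_mod_cast hpos
  have hlog : log (2 * Z.card) ≤ R * ℓ := by
    have h2 : 2 * (Z.card : ℝ) ≤ (6 / δ) ^ (r ^ d) :=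
      calc 2 * (Z.card : ℝ) ≤ 2 ^ (r ^ d) * (3 / δ) ^ (r ^ d) := by
            gcongr
            exact le_self_pow₀ one_le_two (by positivity)
        _ = (6 / δ) ^ (r ^ d) := by
            rw [← mul_pow]
            congr 1
            ring
    calc log (2 * Z.card) ≤ log ((6 / δ) ^ (r ^ d)) := log_le_log (by positivity) h2
      _ = R * ℓ := by
          rw [log_pow]
          push_cast
          rfl
  set k : ℕ := ⌈2 / δ * (R * ℓ)⌉₊ with hkdef
  have hk1 : 2 / δ * (R * ℓ) ≤ k := Nat.le_ceil _
  have hk2 : (k : ℝ) < 2 / δ * (R * ℓ) + 1 := Nat.ceil_lt_add_one (by positivity)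
  have hk : (Z.card : ℝ) ≤ cosh (k * (δ / 2)) := by
    have h1 : R * ℓ ≤ k * (δ / 2) := by
      calc R * ℓ = 2 / δ * (R * ℓ) * (δ / 2) := by field_simp
        _ ≤ k * (δ / 2) := by gcongr
    have h2 : 2 * (Z.card : ℝ) ≤ exp (k * (δ / 2)) := by
      rw [← exp_log (show 0 < 2 * (Z.card : ℝ) by positivity)]
      exact exp_le_exp.2 (hlog.trans h1)
    rw [cosh_eq]
    linarith [exp_pos (-(k * (δ / 2)))]
  have hcard := card_le_of_separated_of_cpRank hd (by omega) hδ hδ1 Z hZ hs hcp k hk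
  set q : ℕ := d * r ^ 2 with hq
  set p : ℕ := q - r with hp
  have hpq : p + 1 ≤ q - 1 := by
    have : 2 * r ≤ q := by
      rw [hq]
      nlinarith
    omega
  have hqR : (1 : ℝ) ≤ q := by exact_mod_cast (by omega : 1 ≤ q)
  have hpqR : (p : ℝ) ≤ q := by exact_mod_cast (by omega : p ≤ q)
  have h2k : (2 * k + 1 : ℝ) ≤ 7 * R / δ * ℓ := by
    have hX : 1 ≤ R * ℓ / δ := by
      rw [le_div_iff₀ hδ]
      nlinarith
    calc (2 * k + 1 : ℝ) ≤ 2 * (2 / δ * (R * ℓ) + 1) + 1 := by linarith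
      _ = 4 * (R * ℓ / δ) + 3 := by ring
      _ ≤ 7 * (R * ℓ / δ) := by linarith
      _ = 7 * R / δ * ℓ := by ring
  have hbase : 1 ≤ 7 * R * q / δ := by
    rw [le_div_iff₀ hδ]
    nlinarith
  calc (Z.card : ℝ) ≤ (2 * k + 1 : ℝ) ^ p := by exact_mod_cast hcard
    _ ≤ (7 * R / δ * ℓ) ^ p := by gcongr
    _ = (7 * R / δ) ^ p * ℓ ^ p := mul_pow _ _ _
    _ ≤ (7 * R / δ) ^ p * ((p : ℝ) ^ p * exp ℓ) := by
        gcongr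
        exact pow_le_pow_mul_exp (by linarith) p
    _ = (7 * R / δ) ^ p * ((p : ℝ) ^ p * (6 / δ)) := by rw [hℓ, exp_log (by positivity)]
    _ ≤ (7 * R / δ) ^ p * ((q : ℝ) ^ p * (7 * R * q / δ)) := by
        have : (6 : ℝ) ≤ 7 * R * q := by nlinarith
        gcongr
    _ = (7 * R * q / δ) ^ (p + 1) := by
        rw [pow_succ, ← mul_assoc, ← mul_pow]
        congr 2
        ring
    _ ≤ (7 * R * q / δ) ^ (q - 1) := pow_le_pow_right₀ hbase hpq
    _ = (7 * R * q) ^ (q - 1) * (1 / δ) ^ (q - 1) := by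
        rw [← mul_pow]
        congr 1
        ring
    _ ≤ ((r : ℝ) ^ (5 * d)) ^ q * (1 / δ) ^ (q - 1) := by
        have h7 : 7 * R * q ≤ (r : ℝ) ^ (5 * d) := by
          rw [hR, hq]
          exact_mod_cast seven_mul_le_pow hd hr
        have h1 : 1 ≤ (r : ℝ) ^ (5 * d) := one_le_pow₀ (by exact_mod_cast (by omega : 1 ≤ r))
        gcongr
        calc (7 * R * q) ^ (q - 1) ≤ ((r : ℝ) ^ (5 * d)) ^ (q - 1) := by gcongr
          _ ≤ ((r : ℝ) ^ (5 * d)) ^ q := pow_le_pow_right₀ h1 (Nat.sub_le _ _)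
    _ = (r : ℝ) ^ (5 * d ^ 2 * r ^ 2) * (1 / δ) ^ (q - 1) := by
        rw [← pow_mul, hq]
        congr 2
        ring

/-- A net for the tensors of format `r × ⋯ × r` and CP rank at most `r` in the unit ball. -/
lemma exists_core_net {d r : ℕ} (hd : 2 ≤ d) (hr : 1 ≤ r) {δ : ℝ} (hδ : 0 < δ) (hδ1 : δ ≤ 1) :
    ∃ Z : Finset (EuclideanSpace ℝ (Fin d → Fin r)),
      (Z.card : ℝ) ≤ (r : ℝ) ^ (5 * d ^ 2 * r ^ 2) * (3 / δ) ^ (d * r ^ 2 - 1) ∧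
      ∀ x, CPRankLE (n := fun _ : Fin d => r) r x → ‖x‖ ≤ 1 → ∃ z ∈ Z, dist x z < δ := by
  set B : ℝ := (r : ℝ) ^ (5 * d ^ 2 * r ^ 2) * (3 / δ) ^ (d * r ^ 2 - 1) with hB
  have hB0 : 0 ≤ B := by positivity
  have h3 : 1 ≤ 3 / δ := by
    rw [le_div_iff₀ hδ]
    linarith
  have hbound : ∀ Z : Finset (EuclideanSpace ℝ (Fin d → Fin r)),
      (Z : Set (EuclideanSpace ℝ (Fin d → Fin r))) ⊆
        {x | CPRankLE (n := fun _ : Fin d => r) r x ∧ ‖x‖ ≤ 1} →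
      (∀ x ∈ Z, ∀ y ∈ Z, x ≠ y → δ ≤ dist x y) → (Z.card : ℝ) ≤ B := by
    intro Z hZ hs
    rcases hr.eq_or_lt with rfl | hr2
    · have := card_le_of_separated_of_norm_le hδ zero_le_one Z (fun z hz => (hZ hz).2) hs
      simp only [finrank_euclideanSpace, Fintype.card_pi, Fintype.card_fin, Finset.prod_const,
        Finset.card_univ, one_pow, pow_one, mul_one] at this
      simp only [hB, Nat.cast_one, one_pow, one_mul, mul_one]
      calc (Z.card : ℝ) ≤ 1 + 2 / δ := this
        _ ≤ 3 / δ := by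
            rw [le_div_iff₀ hδ, add_mul, div_mul_cancel₀ _ hδ.ne']
            linarith
        _ ≤ (3 / δ) ^ (d - 1) := le_self_pow₀ h3 (by omega)
    · refine (card_le_of_separated_of_cpRank_of_two_le hd hr2 hδ hδ1 Z
        (fun z hz => (hZ hz).2) hs fun z hz => (hZ hz).1).trans ?_
      rw [hB]
      gcongr
      norm_num
  obtain ⟨Z, hZ, hs, hnet⟩ := exists_separated_net
    {x : EuclideanSpace ℝ (Fin d → Fin r) | CPRankLE (n := fun _ : Fin d => r) r x ∧ ‖x‖ ≤ 1}
    hδ ⌊B⌋₊ fun Z hZ hs => Nat.le_floor (hbound Z hZ hs)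
  exact ⟨Z, hbound Z hZ hs, fun x hx hx1 => hnet x ⟨hx, hx1⟩⟩

end CoreNet

section CPNet

open scoped Matrix.Norms.L2Operator Matrix

lemma CPRankLE.smul {d : ℕ} (hd : 0 < d) {n : Fin d → ℕ} {r : ℕ}
    {T : EuclideanSpace ℝ (∀ i, Fin (n i))} (hT : CPRankLE r T) (c : ℝ) : CPRankLE r (c • T) := by
  obtain ⟨a, ha⟩ := hT
  let i₀ : Fin d := ⟨0, hd⟩
  refine ⟨fun j => Function.update (a j) i₀ (c • a j i₀), fun k => ?_⟩
  rw [PiLp.smul_apply, ha, smul_eq_mul, Finset.mul_sum]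
  refine Finset.sum_congr rfl fun j _ => ?_
  simp only
  rw [← Finset.mul_prod_erase _ _ (Finset.mem_univ i₀),
    ← Finset.mul_prod_erase _ _ (Finset.mem_univ i₀), Function.update_self, Pi.smul_apply,
    smul_eq_mul, mul_assoc]
  congr 2
  refine Finset.prod_congr rfl fun i hi => ?_
  rw [Function.update_of_ne (Finset.ne_of_mem_erase hi)]

/-- A net for the unit tensors of CP rank at most `r`. -/
lemma exists_cp_net {d r : ℕ} {n : Fin d → ℕ} (hd : 2 ≤ d) (hr : 1 ≤ r) (hrn : ∀ i, r ≤ n i)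
    {ε : ℝ} (hε : 0 < ε) (hε1 : ε ≤ 1) :
    ∃ Z : Finset (EuclideanSpace ℝ (∀ i, Fin (n i))),
      (Z.card : ℝ) ≤ (∏ i, (5 : ℝ) ^ (n i * r) * (7 / (ε / (8 * d))) ^ (r * (n i - r))) *
        ((r : ℝ) ^ (5 * d ^ 2 * r ^ 2) * (3 / (ε / 8)) ^ (d * r ^ 2 - 1)) ∧
      ∀ x, CPRankLE r x → ‖x‖ = 1 → ∃ y ∈ Z, ‖x - y‖ ≤ ε / 4 := by
  classical
  have hdR : (2 : ℝ) ≤ d := by exact_mod_cast hd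
  have hδ : 0 < ε / (8 * d) := by positivity
  have hδ1 : ε / (8 * d) ≤ 1 := by
    rw [div_le_one (by positivity)]
    linarith
  choose F hF hFcard hFnet using fun i => exists_frame_net (n i) r hδ hδ1
  obtain ⟨S, hScard, hSnet⟩ := exists_core_net hd hr (δ := ε / 8) (by positivity) (by linarith)
  let Φ : (∀ i, Matrix (Fin (n i)) (Fin r) ℝ) × EuclideanSpace ℝ (Fin d → Fin r) →
      EuclideanSpace ℝ (∀ i, Fin (n i)) := fun q =>
    WithLp.toLp 2 (kron (m := n) (n := fun _ => r) q.1 *ᵥ q.2.ofLp)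
  refine ⟨((Fintype.piFinset F) ×ˢ S).image Φ, ?_, fun x hx hx1 => ?_⟩
  · calc ((((Fintype.piFinset F) ×ˢ S).image Φ).card : ℝ)
        ≤ (((Fintype.piFinset F) ×ˢ S).card : ℝ) := by exact_mod_cast Finset.card_image_le
      _ = (∏ i, ((F i).card : ℝ)) * S.card := by
          rw [Finset.card_product, Fintype.card_piFinset]
          push_cast
          rfl
      _ ≤ _ := by
          gcongr with i
          exact hFcard i
  · obtain ⟨a, ha⟩ := hx
    have hxa : x.ofLp = fun k => ∑ j, ∏ i, a j i (k i) := funext ha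
    choose U hU hUa using fun i => exists_frame_containing (hrn i) fun j => a j i
    choose V hV hUV using fun i => hFnet i (U i) (hU i)
    have hVV : ∀ i, (V i)ᵀ * V i = 1 := fun i => hF i (V i) (hV i)
    have hfix : ∀ i, kronAt i (U i * (U i)ᵀ) *ᵥ x.ofLp = x.ofLp := by
      intro i
      rw [hxa, kronAt, kron_mulVec_cp]
      ext k
      refine Finset.sum_congr rfl fun j _ => Finset.prod_congr rfl fun l _ => ?_
      rcases eq_or_ne l i with rfl | hl
      · rw [Function.update_self, hUa]
      · rw [Function.update_of_ne hl, Matrix.one_mulVec]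
    let y : EuclideanSpace ℝ (Fin d → Fin r) :=
      WithLp.toLp 2 (kron (m := fun _ => r) (n := n) (fun i => (V i)ᵀ) *ᵥ x.ofLp)
    have hy : CPRankLE (n := fun _ : Fin d => r) r y := by
      refine ⟨fun j i => (V i)ᵀ *ᵥ a j i, fun k => ?_⟩
      simp only [y]
      rw [hxa, kron_mulVec_cp]
    have hy1 : ‖y‖ ≤ 1 := (norm_kron_transpose_mulVec_le V hVV x.ofLp).trans_eq hx1
    obtain ⟨s, hs, hys⟩ := hSnet y hy hy1
    refine ⟨Φ (V, s), Finset.mem_image_of_mem _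
      (Finset.mem_product.2 ⟨Fintype.mem_piFinset.2 hV, hs⟩), ?_⟩
    have e : x - Φ (V, s) =
        WithLp.toLp 2 (x.ofLp - kron (fun i => V i * (V i)ᵀ) *ᵥ x.ofLp) +
        WithLp.toLp 2 (kron (m := n) (n := fun _ => r) V *ᵥ (y.ofLp - s.ofLp)) := by
      rw [← WithLp.toLp_add, Matrix.mulVec_sub]
      simp only [y, Matrix.mulVec_mulVec]
      rw [kron_mul, sub_add_sub_cancel]
      rfl
    rw [e]
    refine (norm_add_le _ _).trans ?_
    rw [norm_kron_mulVec_of_frames V hVV]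
    have h1 := norm_sub_kron_proj_le U V hU hVV hUV x.ofLp hfix
    have h2 : ‖WithLp.toLp 2 (y.ofLp - s.ofLp)‖ < ε / 8 := by
      rw [dist_eq_norm] at hys
      exact hys
    have h3 : (d : ℝ) * (ε / (8 * d)) * ‖WithLp.toLp 2 x.ofLp‖ = ε / 8 := by
      rw [WithLp.toLp_ofLp, hx1]
      field_simp
    rw [h3] at h1
    linarith

lemma angle_le_of_norm_sub_le {E : Type*} [NormedAddCommGroup E] [InnerProductSpace ℝ E]
    {x y : E} {ρ : ℝ} (hx : ‖x‖ = 1) (hρ : ρ < 1) (hxy : ‖x - y‖ ≤ ρ) :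
    InnerProductGeometry.angle x y ≤ 2 * ρ := by
  set φ := InnerProductGeometry.angle x y with hφ
  have hρ0 : 0 ≤ ρ := (norm_nonneg _).trans hxy
  have hc : cos φ * ‖y‖ = inner ℝ x y := by
    have := InnerProductGeometry.cos_angle_mul_norm_mul_norm x y
    rwa [hx, one_mul] at this
  have hsq : ‖x - y‖ ^ 2 = 1 - 2 * (cos φ * ‖y‖) + ‖y‖ ^ 2 := by
    rw [norm_sub_sq_real, hx, hc]
    ring
  have hsq' : ‖x - y‖ ^ 2 ≤ ρ ^ 2 := pow_le_pow_left₀ (norm_nonneg _) hxy 2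
  have hφ0 : 0 ≤ φ := InnerProductGeometry.angle_nonneg _ _
  have hcos : 0 ≤ cos φ := by
    by_contra! hneg
    nlinarith [mul_nonneg (neg_nonneg.2 hneg.le) (norm_nonneg y), sq_nonneg ‖y‖]
  have hφ1 : φ ≤ π / 2 := by
    by_contra! hgt
    have := cos_neg_of_pi_div_two_lt_of_lt hgt
      (by linarith [InnerProductGeometry.angle_le_pi x y, pi_pos])
    linarith
  have hsin : sin φ ≤ ρ := by
    refine abs_le_of_sq_le_sq' ?_ hρ0 |>.2
    nlinarith [sin_sq_add_cos_sq φ, sq_nonneg (‖y‖ - cos φ)]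
  have h1 := (mul_le_sin hφ0 hφ1).trans hsin
  rw [div_mul_eq_mul_div, div_le_iff₀ pi_pos] at h1
  nlinarith [pi_le_four]

lemma measure_cp_close_le_card {d r : ℕ} {n : Fin d → ℕ} (hd : 0 < d) {ε : ℝ} (hε : 0 < ε)
    (hε6 : ε ≤ π / 6) (Z : Finset (EuclideanSpace ℝ (∀ i, Fin (n i))))
    (hZ : ∀ x, CPRankLE r x → ‖x‖ = 1 → ∃ y ∈ Z, ‖x - y‖ ≤ ε / 4) :
    _root_.stdGaussian (∀ i, Fin (n i))
      {T | ∃ T', CPRankLE r T' ∧ T' ≠ 0 ∧ InnerProductGeometry.angle T T' ≤ ε} ≤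
      ENNReal.ofReal (Z.card * sin (2 * ε) ^ (∏ i, n i - 1)) := by
  have hpi := pi_le_four
  calc _root_.stdGaussian (∀ i, Fin (n i))
        {T | ∃ T', CPRankLE r T' ∧ T' ≠ 0 ∧ InnerProductGeometry.angle T T' ≤ ε}
      ≤ _root_.stdGaussian (∀ i, Fin (n i))
        (⋃ y ∈ Z, {T | InnerProductGeometry.angle T y ≤ 2 * ε}) := by
        refine measure_mono ?_
        rintro T ⟨T', hcp, hne, hT⟩
        have hn : 0 < ‖T'‖ := norm_pos_iff.2 hne
        obtain ⟨y, hy, hxy⟩ := hZ (‖T'‖⁻¹ • T') (hcp.smul hd _) (by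
          rw [norm_smul, norm_inv, norm_norm, inv_mul_cancel₀ hn.ne'])
        have h1 := angle_le_of_norm_sub_le (by
          rw [norm_smul, norm_inv, norm_norm, inv_mul_cancel₀ hn.ne']) (by linarith) hxy
        rw [InnerProductGeometry.angle_smul_left_of_pos _ _ (inv_pos.2 hn)] at h1
        have h2 := InnerProductGeometry.angle_le_angle_add_angle T T' y
        simp only [Set.mem_iUnion]
        exact ⟨y, hy, by simp only [Set.mem_ofPred_eq]; linarith⟩
    _ ≤ ∑ y ∈ Z, _root_.stdGaussian (∀ i, Fin (n i))
        {T | InnerProductGeometry.angle T y ≤ 2 * ε} := measure_biUnion_finset_le _ _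
    _ ≤ ∑ y ∈ Z, ENNReal.ofReal (sin (2 * ε) ^ (∏ i, n i - 1)) := by
        refine Finset.sum_le_sum fun y _ => ?_
        have := stdGaussian_angle_le y (θ := 2 * ε) (by linarith) (by linarith [pi_pos])
        simpa using this
    _ = _ := by
        rw [Finset.sum_const, nsmul_eq_mul, ENNReal.ofReal_mul (by positivity),
          ENNReal.ofReal_natCast]

end CPNet

section Assembly

lemma sum_mul_sub_add {d r : ℕ} {n : Fin d → ℕ} (hrn : ∀ i, r ≤ n i) :
    ∑ i, r * (n i - r) + d * r ^ 2 = r * ∑ i, n i := by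
  have h : d * r ^ 2 = ∑ _i : Fin d, r * r := by
    simp [sq]
  rw [h, ← Finset.sum_add_distrib, Finset.mul_sum]
  refine Finset.sum_congr rfl fun i _ => ?_
  rw [← Nat.mul_add, Nat.sub_add_cancel (hrn i)]

lemma cp_net_card_le {d r : ℕ} {n : Fin d → ℕ} (hd : 1 ≤ d) (hr : 1 ≤ r) (hrn : ∀ i, r ≤ n i)
    {ε : ℝ} (hε : 0 < ε) :
    (∏ i, (5 : ℝ) ^ (n i * r) * (7 / (ε / (8 * d))) ^ (r * (n i - r))) *
        ((r : ℝ) ^ (5 * d ^ 2 * r ^ 2) * (3 / (ε / 8)) ^ (d * r ^ 2 - 1)) ≤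
      (280 * d) ^ (r * ∑ i, n i) * (r : ℝ) ^ (5 * d ^ 2 * r ^ 2) / ε ^ (r * ∑ i, n i - 1) := by
  have hsum := sum_mul_sub_add hrn
  have hdR : (1 : ℝ) ≤ d := by exact_mod_cast hd
  have hq : 1 ≤ d * r ^ 2 := Nat.mul_pos hd (by positivity)
  rw [Finset.prod_mul_distrib, Finset.prod_pow_eq_pow_sum, Finset.prod_pow_eq_pow_sum,
    ← Finset.sum_mul, mul_comm (∑ i, n i) r]
  set D := r * ∑ i, n i
  set m := ∑ i, r * (n i - r)
  set q := d * r ^ 2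
  set K := (r : ℝ) ^ (5 * d ^ 2 * r ^ 2)
  have h1 : 7 / (ε / (8 * d)) = 56 * d / ε := by
    field_simp
    norm_num
  have h2 : 3 / (ε / 8) = 24 / ε := by
    field_simp
    norm_num
  have hD1 : D - 1 = m + (q - 1) := by omega
  have h3 : (24 : ℝ) ^ (q - 1) ≤ (56 * d) ^ q :=
    calc (24 : ℝ) ^ (q - 1) ≤ (56 * d) ^ (q - 1) := by
          gcongr
          linarith
      _ ≤ (56 * d) ^ q := pow_le_pow_right₀ (by linarith) (Nat.sub_le _ _)
  calc (5 : ℝ) ^ D * (7 / (ε / (8 * d))) ^ m * (K * (3 / (ε / 8)) ^ (q - 1))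
      = 5 ^ D * (56 * d) ^ m * 24 ^ (q - 1) * K / ε ^ (D - 1) := by
        rw [h1, h2, hD1, pow_add, div_pow, div_pow]
        field_simp
    _ ≤ 5 ^ D * (56 * d) ^ m * (56 * d) ^ q * K / ε ^ (D - 1) := by gcongr
    _ = (280 * d) ^ D * K / ε ^ (D - 1) := by
        rw [mul_assoc ((5 : ℝ) ^ D), ← pow_add, hsum, ← mul_pow]
        congr 3
        ring

lemma sqrt_prod_le_two_pow {d r : ℕ} (n : Fin d → ℕ) (hr : 1 ≤ r) (hN : 1 ≤ ∏ i, n i) :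
    √((∏ i, n i : ℕ) : ℝ) ≤ 2 ^ (r * ∑ i, n i) := by
  have h1 : ∏ i, n i ≤ 2 ^ ∑ i, n i := by
    rw [← Finset.prod_pow_eq_pow_sum]
    exact Finset.prod_le_prod' fun i _ => Nat.lt_two_pow_self.le
  have h2 : ∏ i, n i ≤ 2 ^ (r * ∑ i, n i) :=
    h1.trans (Nat.pow_le_pow_right two_pos (Nat.le_mul_of_pos_left _ hr))
  have hN' : (1 : ℝ) ≤ (∏ i, n i : ℕ) := by exact_mod_cast hN
  rw [sqrt_le_left (by positivity)]
  have h3 : ((∏ i, n i : ℕ) : ℝ) ≤ 2 ^ (r * ∑ i, n i) := by exact_mod_cast h2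
  nlinarith

lemma pow_le_pow_two_mul_mul {d r : ℕ} {n : Fin d → ℕ} (hn : ∀ i, 2 ≤ n i) (hr : 1 ≤ r)
    (hrn : ∀ i, r ≤ n i) :
    (560 : ℝ) ^ (r * ∑ i, n i) ≤
      560 ^ (2 * ∑ i, r * (n i - r)) * (r : ℝ) ^ (10 * d ^ 2 * r ^ 2) := by
  rw [← sum_mul_sub_add hrn]
  rcases hr.eq_or_lt with rfl | hr2
  · have h : d ≤ ∑ i, 1 * (n i - 1) := by
      calc d = ∑ _i : Fin d, 1 := by simp
        _ ≤ ∑ i, 1 * (n i - 1) := Finset.sum_le_sum fun i _ => by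
            have := hn i
            omega
    simp only [Nat.cast_one, one_pow, mul_one]
    exact pow_le_pow_right₀ (by norm_num) (by omega)
  · have hrR : (2 : ℝ) ≤ r := by exact_mod_cast hr2
    rw [pow_add]
    gcongr
    · norm_num
    · omega
    · calc (560 : ℝ) ^ (d * r ^ 2) ≤ (2 ^ 10) ^ (d * r ^ 2) := by
            gcongr
            norm_num
        _ ≤ ((r : ℝ) ^ 10) ^ (d * r ^ 2) := by gcongr
        _ = (r : ℝ) ^ (10 * d * r ^ 2) := by
            rw [← pow_mul]
            congr 1
            ring
        _ ≤ (r : ℝ) ^ (10 * d ^ 2 * r ^ 2) := by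
            refine pow_le_pow_right₀ (by linarith) ?_
            gcongr
            exact Nat.le_self_pow two_ne_zero d

lemma entropy_factor_le {d r : ℕ} {n : Fin d → ℕ} (hn : ∀ i, 2 ≤ n i) (hN : 1 ≤ ∏ i, n i)
    (hr : 1 ≤ r) (hrn : ∀ i, r ≤ n i) :
    (280 * d : ℝ) ^ (r * ∑ i, n i) * (r : ℝ) ^ (5 * d ^ 2 * r ^ 2) ≤
      ((560 ^ 2 : ℝ) * d) ^ (r * ∑ i, n i) * (r : ℝ) ^ ((15 : ℝ) * (d : ℝ) ^ 2 * (r : ℝ) ^ 2) /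
        (√((∏ i, n i : ℕ) : ℝ) * (560 ^ 2 : ℝ) ^ (d * r ^ 2)) := by
  have h1 := sqrt_prod_le_two_pow n hr hN
  have h2 := pow_le_pow_two_mul_mul hn hr hrn
  have hsum := sum_mul_sub_add hrn
  have hexp : (r : ℝ) ^ ((15 : ℝ) * (d : ℝ) ^ 2 * (r : ℝ) ^ 2) =
      (r : ℝ) ^ (10 * d ^ 2 * r ^ 2) * (r : ℝ) ^ (5 * d ^ 2 * r ^ 2) := by
    rw [← pow_add, ← rpow_natCast (r : ℝ) (10 * d ^ 2 * r ^ 2 + 5 * d ^ 2 * r ^ 2)]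
    congr 1
    push_cast
    ring
  have hN0 : 0 < √((∏ i, n i : ℕ) : ℝ) := sqrt_pos.2 (by exact_mod_cast hN)
  rw [hexp, le_div_iff₀ (by positivity), mul_pow, mul_pow]
  set D := r * ∑ i, n i
  set m := ∑ i, r * (n i - r)
  set q := d * r ^ 2
  set K := (r : ℝ) ^ (5 * d ^ 2 * r ^ 2)
  set K' := (r : ℝ) ^ (10 * d ^ 2 * r ^ 2)
  calc (280 : ℝ) ^ D * (d : ℝ) ^ D * K * (√((∏ i, n i : ℕ) : ℝ) * (560 ^ 2) ^ q)
      ≤ 280 ^ D * (d : ℝ) ^ D * K * (2 ^ D * (560 ^ 2) ^ q) := by gcongr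
    _ = 560 ^ D * (560 ^ 2) ^ q * ((d : ℝ) ^ D * K) := by
        rw [show (560 : ℝ) ^ D = 280 ^ D * 2 ^ D by rw [← mul_pow]; norm_num]
        ring
    _ ≤ (560 ^ (2 * m) * K') * (560 ^ 2) ^ q * ((d : ℝ) ^ D * K) := by gcongr
    _ = (560 ^ 2) ^ D * (d : ℝ) ^ D * (K' * K) := by
        rw [← hsum, pow_add (560 ^ 2 : ℝ) m q, pow_mul]
        ring

lemma le_sin_two_mul {ε : ℝ} (hε : 0 < ε) (hε6 : ε ≤ π / 6) : ε ≤ sin (2 * ε) := by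
  have h := mul_le_sin (x := 2 * ε) (by linarith) (by linarith [pi_pos])
  refine le_trans ?_ h
  rw [div_mul_eq_mul_div, le_div_iff₀ pi_pos]
  nlinarith [pi_le_four]

lemma measure_cp_close_le {d r : ℕ} {n : Fin d → ℕ} (hd : 1 ≤ d) (hr : 1 ≤ r)
    (hrn : ∀ i, r ≤ n i) {ε : ℝ} (hε : 0 < ε) (hε6 : ε ≤ π / 6) :
    _root_.stdGaussian (∀ i, Fin (n i))
      {T | ∃ T', CPRankLE r T' ∧ T' ≠ 0 ∧ InnerProductGeometry.angle T T' ≤ ε} ≤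
      ENNReal.ofReal (sin (2 * ε) ^ (∏ i, n i - 1) / ε ^ (r * ∑ i, n i - 1) *
        ((280 * d) ^ (r * ∑ i, n i) * (r : ℝ) ^ (5 * d ^ 2 * r ^ 2))) := by
  have hε1 : ε ≤ 1 := by linarith [pi_le_four]
  have hsin := le_sin_two_mul hε hε6
  rcases hd.eq_or_lt with rfl | hd2
  · have : IsProbabilityMeasure (_root_.stdGaussian (∀ i, Fin (n i))) :=
      Measure.isProbabilityMeasure_map (MeasurableEquiv.measurable _).aemeasurable
    refine prob_le_one.trans ?_
    rw [← ENNReal.ofReal_one]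
    refine ENNReal.ofReal_le_ofReal ?_
    have hrR : (1 : ℝ) ≤ r := by exact_mod_cast hr
    have h1 : 1 ≤ sin (2 * ε) ^ (∏ i, n i - 1) / ε ^ (r * ∑ i, n i - 1) := by
      rw [one_le_div (by positivity)]
      calc ε ^ (r * ∑ i, n i - 1) ≤ ε ^ (∏ i, n i - 1) := by
            refine pow_le_pow_of_le_one hε.le hε1 (Nat.sub_le_sub_right ?_ 1)
            simp only [Fin.prod_univ_one, Fin.sum_univ_one]
            exact Nat.le_mul_of_pos_left _ hr
        _ ≤ sin (2 * ε) ^ (∏ i, n i - 1) := by gcongr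
    refine one_le_mul_of_one_le_of_one_le h1
      (one_le_mul_of_one_le_of_one_le (one_le_pow₀ (by norm_num)) (one_le_pow₀ hrR))
  · obtain ⟨Z, hZcard, hZ⟩ := exists_cp_net hd2 hr hrn hε hε1
    refine (measure_cp_close_le_card hd hε hε6 Z hZ).trans (ENNReal.ofReal_le_ofReal ?_)
    have hs : 0 ≤ sin (2 * ε) := hε.le.trans hsin
    calc (Z.card : ℝ) * sin (2 * ε) ^ (∏ i, n i - 1)
        ≤ (280 * d) ^ (r * ∑ i, n i) * (r : ℝ) ^ (5 * d ^ 2 * r ^ 2) / ε ^ (r * ∑ i, n i - 1) *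
          sin (2 * ε) ^ (∏ i, n i - 1) := by
          gcongr
          exact hZcard.trans (cp_net_card_le hd hr hrn hε)
      _ = _ := by ring

end Assembly

/-- A standard Gaussian tensor is `ε`-close in angle to a tensor of CP rank at most
`r ≤ minᵢ nᵢ` with probability at most
`sin(2ε)^{N−1}·ε^{−(rΣnᵢ−1)}·(c₁d)^{rΣnᵢ}·r^{c₂d²r²}/(√N·c₁^{dr²})`. -/
theorem prob_gaussian_tensor_close_to_low_cp_rank : ∃ c₁ c₂ : ℝ, 1 ≤ c₁ ∧ 1 ≤ c₂ ∧
    ∀ (d : ℕ), 1 ≤ d → ∀ (n : Fin d → ℕ), (∀ i, 2 ≤ n i) → 8 ≤ ∏ i, n i →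
    ∀ (r : ℕ), 1 ≤ r → (∀ i, r ≤ n i) →
    ∀ ε : ℝ, 0 < ε → ε ≤ π / 6 →
    stdGaussian ((i : Fin d) → Fin (n i))
      {T : EuclideanSpace ℝ ((i : Fin d) → Fin (n i)) |
        ∃ T', CPRankLE r T' ∧ T' ≠ 0 ∧ InnerProductGeometry.angle T T' ≤ ε}
      ≤ ENNReal.ofReal
          (Real.sin (2 * ε) ^ (∏ i, n i - 1) / ε ^ (r * ∑ i, n i - 1)
            * ((c₁ * d) ^ (r * ∑ i, n i)
                * (r : ℝ) ^ (c₂ * (d : ℝ) ^ 2 * (r : ℝ) ^ 2)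
              / (Real.sqrt (∏ i, n i) * c₁ ^ (d * r ^ 2)))) := by
  refine ⟨560 ^ 2, 15, by norm_num, by norm_num, ?_⟩
  intro d hd n hn hN r hr hrn ε hε hε6
  refine (measure_cp_close_le hd hr hrn hε hε6).trans (ENNReal.ofReal_le_ofReal ?_)
  have hs : 0 ≤ sin (2 * ε) := hε.le.trans (le_sin_two_mul hε hε6)
  gcongr
  simpa using entropy_factor_le hn (by omega : 1 ≤ ∏ i, n i) hr hrn
end

section
/- There exists an absolute constant C > 0 with the following property. Let n, N ≥ 1 and d ≥ 2 be integers and let p : ℝ^n → ℝ^N be a polynomial map of degree at most d that is not identically zero. Let W = {p(x)/‖p(x)‖ : x ∈ ℝ^n, p(x) ≠ 0} and N' = min{N, n^d}. Then the Gaussian width of W satisfies E_g[ sup_{w ∈ W} ⟨g, w⟩ ] ≤ C·√(n·log(n·d·N')), where g is a standard Gaussian random vector in ℝ^N (i.e., g has N independent standard Gaussian coordinates). -/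
open MeasureTheory ProbabilityTheory

/-- The polynomial map `ℝ^n → ℝ^N` whose coordinate functions are the
polynomials `P i`. -/
noncomputable def polyMap {n N : ℕ} (P : Fin N → MvPolynomial (Fin n) ℝ)
    (x : Fin n → ℝ) : EuclideanSpace ℝ (Fin N) :=
  WithLp.toLp 2 fun i => MvPolynomial.eval x (P i)

/-- A bounded spanning family in a finite-dimensional space contains `finrank` many vectors in
terms of which every member of the family has coefficients bounded by `2`: almost maximize the
determinant and apply Cramer's rule. -/
theorem exists_points_coeff_le_two {X F : Type*} [NormedAddCommGroup F] [NormedSpace ℝ F]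
    [FiniteDimensional ℝ F] (v : X → F) (hspan : Submodule.span ℝ (Set.range v) = ⊤)
    (hv : Bornology.IsBounded (Set.range v)) :
    ∃ y : Fin (Module.finrank ℝ F) → X, ∀ x, ∃ c : Fin (Module.finrank ℝ F) → ℝ,
      (∀ j, |c j| ≤ 2) ∧ v x = ∑ j, c j • v (y j) := by
  classical
  let e := Module.finBasis ℝ F
  have hcont : Continuous fun f : Fin (Module.finrank ℝ F) → F => |e.det f| := by
    simp only [Module.Basis.det_apply]
    refine (Continuous.matrix_det (continuous_matrix fun i j => ?_)).abs
    exact (LinearMap.continuous_of_finiteDimensional (e.coord i)).comp (continuous_apply j)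
  let D : (Fin (Module.finrank ℝ F) → X) → ℝ := fun y => |e.det (v ∘ y)|
  have hbdd : BddAbove (Set.range D) := by
    have hK : IsCompact (Set.univ.pi fun _ : Fin (Module.finrank ℝ F) =>
        closure (Set.range v)) := isCompact_univ_pi fun _ => hv.isCompact_closure
    refine (hK.bddAbove_image hcont.continuousOn).mono ?_
    rintro _ ⟨y, rfl⟩
    exact ⟨v ∘ y, fun i _ => subset_closure ⟨y i, rfl⟩, rfl⟩
  obtain ⟨y₀, hy₀⟩ : ∃ y, 0 < D y := by
    obtain ⟨f, hf, hfs, hfi⟩ := Submodule.exists_fun_fin_finrank_span_eq ℝ (Set.range v)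
    have hr : Module.finrank ℝ (Submodule.span ℝ (Set.range v)) = Module.finrank ℝ F := by
      rw [hspan, finrank_top]
    choose y hy using hf
    refine ⟨y ∘ Fin.cast hr.symm, abs_pos.mpr (IsUnit.ne_zero (e.is_basis_iff_det.mp ⟨?_, ?_⟩))⟩
    · have : v ∘ y ∘ Fin.cast hr.symm = f ∘ Fin.cast hr.symm := by ext i; simp [hy]
      rw [this]
      exact hfi.comp _ (Fin.cast_injective _)
    · have : v ∘ y ∘ Fin.cast hr.symm = f ∘ finCongr hr.symm := by ext i; simp [hy]
      rw [this, (finCongr hr.symm).surjective.range_comp, hfs, hspan]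
  have hpos : 0 < sSup (Set.range D) := hy₀.trans_le (le_csSup hbdd ⟨y₀, rfl⟩)
  obtain ⟨_, ⟨y, rfl⟩, hy⟩ := exists_lt_of_lt_csSup
    (Set.range_nonempty_iff_nonempty.mpr ⟨y₀⟩) (half_lt_self hpos)
  have hDy : 0 < D y := (half_pos hpos).trans hy
  obtain ⟨hli, hsp⟩ := e.is_basis_iff_det.mpr (abs_pos.mp hDy).isUnit
  let b := Module.Basis.mk hli hsp.ge
  refine ⟨y, fun x => ⟨fun j => b.repr (v x) j, fun j => ?_, ?_⟩⟩
  · have h1 := LinearMap.congr_fun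
      (Module.Basis.det_smul_mk_coord_eq_det_update e hli hsp.ge j) (v x)
    have h2 : |e.det (v ∘ y)| * |b.repr (v x) j| = D (Function.update y j x) := by
      rw [← abs_mul]
      simp only [D, Function.comp_update]
      exact congrArg _ h1
    have h3 : D (Function.update y j x) ≤ sSup (Set.range D) := le_csSup hbdd ⟨_, rfl⟩
    have h4 : D y * |b.repr (v x) j| ≤ 2 * D y := by
      have : D y * |b.repr (v x) j| = D (Function.update y j x) := h2
      linarith
    nlinarith
  · conv_lhs => rw [← b.sum_repr (v x)]
    simp [b]

theorem exp_inner_toLp {ι : Type*} [Fintype ι] (w : EuclideanSpace ℝ ι) (x : ι → ℝ) :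
    Real.exp (inner ℝ (MeasurableEquiv.toLp 2 (ι → ℝ) x) w) = ∏ i, Real.exp (w i * x i) := by
  rw [← Real.exp_sum]
  simp [PiLp.inner_apply]

instance {ι : Type*} [Fintype ι] : IsProbabilityMeasure (stdGaussian ι) :=
  Measure.isProbabilityMeasure_map (MeasurableEquiv.measurable _).aemeasurable

theorem integrable_exp_inner_stdGaussian {ι : Type*} [Fintype ι] (w : EuclideanSpace ℝ ι) :
    Integrable (fun g => Real.exp (inner ℝ g w)) (stdGaussian ι) := by
  rw [_root_.stdGaussian, integrable_map_equiv]
  simp only [Function.comp_def, exp_inner_toLp]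
  exact Integrable.fintype_prod fun i => integrable_exp_mul_gaussianReal (w i)

theorem integral_exp_inner_stdGaussian {ι : Type*} [Fintype ι] (w : EuclideanSpace ℝ ι) :
    ∫ g, Real.exp (inner ℝ g w) ∂(stdGaussian ι) = Real.exp (‖w‖ ^ 2 / 2) := by
  rw [_root_.stdGaussian, integral_map_equiv]
  simp only [exp_inner_toLp]
  rw [integral_fintype_prod_eq_prod (fun i t => Real.exp (w i * t))]
  have h (i : ι) : ∫ t, Real.exp (w i * t) ∂(gaussianReal 0 1) = Real.exp (w i ^ 2 / 2) := by
    have := mgf_gaussianReal (p := gaussianReal 0 1) (X := id) Measure.map_id (w i)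
    simpa [mgf] using this
  simp only [h, ← Real.exp_sum, EuclideanSpace.norm_sq_eq, Real.norm_eq_abs, sq_abs,
    Finset.sum_div]

/-- The coordinates of the `m`-fold tensor power of `u`. -/
def tensorPower {ι : Type*} (m : ℕ) (u : ι → ℝ) : (Fin m → ι) → ℝ :=
  fun σ => ∏ i, u (σ i)

theorem sum_tensorPower_mul_tensorPower {ι : Type*} [Fintype ι] (m : ℕ)
    (g u : EuclideanSpace ℝ ι) :
    ∑ σ, tensorPower m g σ * tensorPower m u σ = (inner ℝ g u : ℝ) ^ m := by
  classical
  simp only [tensorPower, ← Finset.prod_mul_distrib]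
  rw [PiLp.inner_apply, Fintype.sum_pow]
  simp [mul_comm]

theorem norm_tensorPower_le_one {ι : Type*} [Fintype ι] (m : ℕ) {u : EuclideanSpace ℝ ι}
    (hu : ‖u‖ ≤ 1) : ‖tensorPower m u‖ ≤ 1 := by
  refine (pi_norm_le_iff_of_nonneg zero_le_one).mpr fun σ => ?_
  rw [tensorPower, norm_prod]
  exact Finset.prod_le_one (fun _ _ => norm_nonneg _)
    fun i _ => (PiLp.norm_apply_le u (σ i)).trans hu

/-- For vectors `w x` of norm at most one, the function `x ↦ |⟨g, w x⟩| ^ m` is controlled, uniformly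
in `g`, by its values at finitely many points, as many as the dimension spanned by the tensor
powers of the `w x`. -/
theorem exists_points_abs_inner_pow_le {X ι : Type*} [Fintype ι] (m : ℕ)
    (w : X → EuclideanSpace ℝ ι) (hw : ∀ x, ‖w x‖ ≤ 1) :
    ∃ y : Fin (Module.finrank ℝ
        (Submodule.span ℝ (Set.range fun x => tensorPower m (w x)))) → X,
      ∀ (g : EuclideanSpace ℝ ι) (x : X),
        |(inner ℝ g (w x) : ℝ)| ^ m ≤ 2 * ∑ j, |(inner ℝ g (w (y j)) : ℝ)| ^ m := by
  set S := Submodule.span ℝ (Set.range fun x => tensorPower m (w x))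
  let v : X → S := fun x => ⟨tensorPower m (w x), Submodule.subset_span ⟨x, rfl⟩⟩
  have hspan : Submodule.span ℝ (Set.range v) = ⊤ := by
    apply Submodule.map_injective_of_injective S.injective_subtype
    rw [Submodule.map_span, Submodule.map_subtype_top, ← Set.range_comp]
    rfl
  have hbdd : Bornology.IsBounded (Set.range v) := by
    refine isBounded_iff_forall_norm_le.mpr ⟨1, ?_⟩
    rintro _ ⟨x, rfl⟩
    exact norm_tensorPower_le_one m (hw x)
  obtain ⟨y, hy⟩ := exists_points_coeff_le_two v hspan hbdd
  refine ⟨y, fun g x => ?_⟩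
  obtain ⟨c, hc, hcx⟩ := hy x
  have key : (inner ℝ g (w x) : ℝ) ^ m = ∑ j, c j * (inner ℝ g (w (y j)) : ℝ) ^ m := by
    have hx : tensorPower m (w x) = ∑ j, c j • tensorPower m (w (y j)) := by
      simpa [v] using congrArg Subtype.val hcx
    simp only [← sum_tensorPower_mul_tensorPower, hx, Finset.sum_apply, Pi.smul_apply,
      smul_eq_mul, Finset.mul_sum]
    rw [Finset.sum_comm]
    exact Finset.sum_congr rfl fun j _ => Finset.sum_congr rfl fun σ _ => by ring
  rw [← abs_pow, key, Finset.mul_sum]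
  refine (Finset.abs_sum_le_sum_abs _ _).trans (Finset.sum_le_sum fun j _ => ?_)
  rw [abs_mul, abs_pow]
  exact mul_le_mul_of_nonneg_right (hc j) (by positivity)

theorem abs_pow_le_factorial_mul_exp {s : ℝ} (hs : 0 < s) (m : ℕ) (t : ℝ) :
    |t| ^ m ≤ m.factorial / s ^ m * (Real.exp (s * t) + Real.exp (-s * t)) := by
  have h1 := Real.pow_div_factorial_le_exp _ (mul_nonneg hs.le (abs_nonneg t)) m
  have h2 : Real.exp (s * |t|) ≤ Real.exp (s * t) + Real.exp (-s * t) := by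
    rcases abs_cases t with ⟨h, -⟩ | ⟨h, -⟩ <;> rw [h]
    · exact le_add_of_nonneg_right (Real.exp_pos _).le
    · rw [mul_neg, neg_mul]
      exact le_add_of_nonneg_left (Real.exp_pos _).le
  have h3 := h1.trans h2
  rw [mul_pow, div_le_iff₀ (by positivity)] at h3
  rw [div_mul_eq_mul_div, le_div_iff₀ (by positivity)]
  linarith

theorem le_add_abs_pow_succ_div {a : ℝ} (ha : 0 < a) (k : ℕ) (t : ℝ) :
    t ≤ a + |t| ^ (k + 1) / a ^ k := by
  rcases le_total |t| a with h | h
  · have : 0 ≤ |t| ^ (k + 1) / a ^ k := by positivity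
    linarith [le_abs_self t]
  · have : |t| ≤ |t| ^ (k + 1) / a ^ k := by
      rw [le_div_iff₀ (by positivity), pow_succ']
      gcongr
    linarith [le_abs_self t]

/-- A moment bound for the Gaussian width of a family of unit vectors. -/
theorem integral_sSup_inner_le {X ι : Type*} [Nonempty X] [Fintype ι] (k : ℕ)
    (w : X → EuclideanSpace ℝ ι) (hw : ∀ x, ‖w x‖ = 1) {a s : ℝ} (ha : 0 < a) (hs : 0 < s) :
    ∫ g, sSup ((fun u => (inner ℝ g u : ℝ)) '' Set.range w) ∂(stdGaussian ι) ≤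
      a + 2 / a ^ k * (Module.finrank ℝ
        (Submodule.span ℝ (Set.range fun x => tensorPower (k + 1) (w x))) *
        ((k + 1).factorial / s ^ (k + 1) * (2 * Real.exp (s ^ 2 / 2)))) := by
  obtain ⟨y, hy⟩ := exists_points_abs_inner_pow_le (k + 1) w fun x => (hw x).le
  set K : ℝ := (k + 1).factorial / s ^ (k + 1)
  have hexp (r : ℝ) (u : EuclideanSpace ℝ ι) :
      Integrable (fun g => Real.exp (r * inner ℝ g u)) (stdGaussian ι) := by
    simpa [inner_smul_right] using integrable_exp_inner_stdGaussian (r • u)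
  have hexp' (r : ℝ) (x : X) :
      ∫ g, Real.exp (r * inner ℝ g (w x)) ∂(stdGaussian ι) = Real.exp (r ^ 2 / 2) := by
    simpa [inner_smul_right, norm_smul, hw] using integral_exp_inner_stdGaussian (r • w x)
  have hsum : Integrable (fun g => ∑ j, K *
      (Real.exp (s * inner ℝ g (w (y j))) + Real.exp (-s * inner ℝ g (w (y j)))))
      (stdGaussian ι) :=
    integrable_finsetSum _ fun j _ => ((hexp s _).add (hexp (-s) _)).const_mul K
  have hint := (integrable_const a).add (hsum.const_mul (2 / a ^ k))
  have hval : ∫ g, (a + 2 / a ^ k * ∑ j, K *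
      (Real.exp (s * inner ℝ g (w (y j))) + Real.exp (-s * inner ℝ g (w (y j)))))
      ∂(stdGaussian ι) = a + 2 / a ^ k * (Module.finrank ℝ
        (Submodule.span ℝ (Set.range fun x => tensorPower (k + 1) (w x))) *
        (K * (2 * Real.exp (s ^ 2 / 2)))) := by
    rw [integral_add (integrable_const a) (hsum.const_mul _), integral_const_mul,
      integral_finsetSum _ fun j _ => by
        exact ((hexp s (w (y j))).add (hexp (-s) (w (y j)))).const_mul K]
    simp only [integral_const_mul, integral_add (hexp s _) (hexp (-s) _), hexp', neg_sq]
    simp [two_mul]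
  have hle (g : EuclideanSpace ℝ ι) : sSup ((fun u => (inner ℝ g u : ℝ)) '' Set.range w) ≤
      a + 2 / a ^ k * ∑ j, K *
      (Real.exp (s * inner ℝ g (w (y j))) + Real.exp (-s * inner ℝ g (w (y j)))) := by
    refine csSup_le ((Set.range_nonempty w).image _) ?_
    rintro _ ⟨_, ⟨x, rfl⟩, rfl⟩
    refine (le_add_abs_pow_succ_div ha k _).trans ?_
    rw [div_mul_eq_mul_div]
    gcongr
    refine (hy g x).trans ?_
    gcongr with j
    exact abs_pow_le_factorial_mul_exp hs _ _
  rw [← hval]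
  by_cases hf : Integrable (fun g => sSup ((fun u => (inner ℝ g u : ℝ)) '' Set.range w))
      (stdGaussian ι)
  · exact integral_mono hf hint hle
  · rw [integral_undef hf, hval]
    positivity

theorem MvPolynomial.eval_eq_sum_fin_pow {n D : ℕ} (Q : MvPolynomial (Fin n) ℝ)
    (hQ : Q.totalDegree ≤ D) (x : Fin n → ℝ) :
    MvPolynomial.eval x Q = ∑ α : Fin n → Fin (D + 1),
      (∏ i, x i ^ (α i : ℕ)) * Q.coeff (Finsupp.equivFunOnFinite.symm fun i => (α i : ℕ)) := by
  rw [MvPolynomial.eval_eq']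
  let φ : (Fin n → Fin (D + 1)) → Fin n →₀ ℕ := fun α =>
    Finsupp.equivFunOnFinite.symm fun i => (α i : ℕ)
  have hφ : Function.Injective φ := fun α β h => by
    ext i
    exact DFunLike.congr_fun h i
  have hsub : Q.support ⊆ Finset.univ.image φ := fun β hβ => by
    have hβD (i : Fin n) : β i < D + 1 := Nat.lt_succ_of_le <|
      (MvPolynomial.monomial_le_degreeOf i hβ).trans
        ((MvPolynomial.degreeOf_le_totalDegree Q i).trans hQ)
    exact Finset.mem_image.mpr ⟨fun i => ⟨β i, hβD i⟩, Finset.mem_univ _, by ext i; simp [φ]⟩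
  rw [Finset.sum_subset hsub fun β _ hβ => by simp [MvPolynomial.notMem_support_iff.mp hβ],
    Finset.sum_image hφ.injOn]
  exact Finset.sum_congr rfl fun α _ => by simp [φ, mul_comm]

theorem finrank_span_tensorPower_le {n N d : ℕ} (m : ℕ) (P : Fin N → MvPolynomial (Fin n) ℝ)
    (hP : ∀ i, (P i).totalDegree ≤ d) {X : Type*} (x : X → Fin n → ℝ) (r : X → ℝ) :
    Module.finrank ℝ (Submodule.span ℝ
      (Set.range fun z => tensorPower m (r z • polyMap P (x z)))) ≤ (m * d + 1) ^ n := by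
  let c : (Fin n → Fin (m * d + 1)) → (Fin m → Fin N) → ℝ := fun α σ =>
    (∏ i, P (σ i)).coeff (Finsupp.equivFunOnFinite.symm fun i => (α i : ℕ))
  have hle : Submodule.span ℝ (Set.range fun z => tensorPower m (r z • polyMap P (x z))) ≤
      Submodule.span ℝ (Set.range c) := by
    rw [Submodule.span_le]
    rintro _ ⟨z, rfl⟩
    have : tensorPower m (r z • polyMap P (x z)) =
        r z ^ m • ∑ α, (∏ i, x z i ^ (α i : ℕ)) • c α := by
      ext σ
      have hdeg : (∏ i, P (σ i)).totalDegree ≤ m * d := by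
        refine (MvPolynomial.totalDegree_finsetProd _ _).trans ?_
        simpa using Finset.sum_le_card_nsmul Finset.univ
          (fun i => (P (σ i)).totalDegree) d fun i _ => hP (σ i)
      have := MvPolynomial.eval_eq_sum_fin_pow _ hdeg (x z)
      rw [map_prod] at this
      simp [tensorPower, polyMap, Finset.prod_mul_distrib, this, c]
    simp only [this]
    exact Submodule.smul_mem _ _ (Submodule.sum_mem _ fun α _ =>
      Submodule.smul_mem _ _ (Submodule.subset_span ⟨α, rfl⟩))
  refine (Submodule.finrank_mono hle).trans ((finrank_range_le_card c).trans ?_)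
  simp

theorem width_bound_le_mul_sqrt {k : ℕ} (hk : 1 ≤ k) {D : ℝ} (hD : D ≤ Real.exp (4 * k)) :
    Real.exp 5 * √(k + 1) + 2 / (Real.exp 5 * √(k + 1)) ^ k *
      (D * ((k + 1).factorial / √(k + 1) ^ (k + 1) * (2 * Real.exp (√(k + 1) ^ 2 / 2)))) ≤
      (Real.exp 5 + 4) * √(k + 1) := by
  set s : ℝ := √(k + 1)
  have hs0 : 0 < s := by positivity
  have hs2 : s ^ 2 = k + 1 := Real.sq_sqrt (by positivity)
  have hfac : ((k + 1).factorial : ℝ) / s ^ (k + 1) ≤ s ^ (k + 1) := by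
    rw [div_le_iff₀ (by positivity), ← mul_pow, ← sq, hs2]
    exact_mod_cast Nat.factorial_le_pow (k + 1)
  have hexp : Real.exp (s ^ 2 / 2) ≤ Real.exp k := by
    rw [hs2]
    have : (1 : ℝ) ≤ k := by exact_mod_cast hk
    exact Real.exp_le_exp.mpr (by linarith)
  have hbound : 2 / (Real.exp 5 * s) ^ k *
      (D * ((k + 1).factorial / s ^ (k + 1) * (2 * Real.exp (s ^ 2 / 2)))) ≤
      2 / (Real.exp 5 * s) ^ k * (Real.exp (4 * k) * (s ^ (k + 1) * (2 * Real.exp k))) := by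
    gcongr
  have heq : 2 / (Real.exp 5 * s) ^ k * (Real.exp (4 * k) * (s ^ (k + 1) * (2 * Real.exp k))) =
      4 * s := by
    have h5 : Real.exp 5 ^ k = Real.exp (4 * k) * Real.exp k := by
      rw [← Real.exp_nat_mul, ← Real.exp_add]
      ring_nf
    rw [mul_pow, h5]
    field_simp
    ring
  linarith

open Real in
theorem natCeil_mul_log_bounds {n d : ℕ} (hn : 1 ≤ n) (hd : 2 ≤ d) {k : ℕ}
    (hk : k = ⌈(n : ℝ) * log (n * d)⌉₊) :
    1 ≤ k ∧ (((k + 1) * d + 1 : ℕ) : ℝ) ^ n ≤ exp (4 * k) ∧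
      (k + 1 : ℝ) ≤ 5 * (n * log (n * d)) := by
  have hn' : (1 : ℝ) ≤ n := by exact_mod_cast hn
  have hd' : (2 : ℝ) ≤ d := by exact_mod_cast hd
  have hy : (2 : ℝ) ≤ n * d := by nlinarith
  have hL : 1 / 2 < log (n * d) := by
    have := log_le_log (by norm_num) hy
    linarith [log_two_gt_d9]
  have hnL : 1 / 2 < n * log (n * d) := by nlinarith
  have hkle : (n : ℝ) * log (n * d) ≤ k := hk ▸ Nat.le_ceil _
  have hklt : (k : ℝ) < n * log (n * d) + 1 := hk ▸ Nat.ceil_lt_add_one (by linarith)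
  refine ⟨?_, ?_, by linarith⟩
  · have : (0 : ℝ) < k := by linarith
    exact_mod_cast this
  · have hLy : log (n * d) ≤ n * d := log_le_self (by linarith)
    have h1 : ((k + 1 : ℝ) * d + 1) ≤ (n * d : ℝ) ^ 4 := by
      have h2 : (k : ℝ) * d ≤ (n * (n * d) + 1) * d := by
        gcongr
        nlinarith
      have h3 : (d : ℝ) ≤ n * d := by nlinarith
      have h4 : ((k + 1 : ℝ) * d + 1) ≤ (n * d + 1) ^ 2 := by nlinarith
      have h5 : (n * d + 1 : ℝ) ≤ (n * d) ^ 2 := by nlinarith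
      calc _ ≤ (n * d + 1 : ℝ) ^ 2 := h4
        _ ≤ ((n * d : ℝ) ^ 2) ^ 2 := by gcongr
        _ = _ := by ring
    calc (((k + 1) * d + 1 : ℕ) : ℝ) ^ n ≤ ((n * d : ℝ) ^ 4) ^ n := by
          push_cast
          gcongr
      _ = exp (4 * (n * log (n * d))) := by
          rw [← pow_mul, ← exp_log (show (0 : ℝ) < n * d by linarith), ← exp_nat_mul, log_exp]
          push_cast
          ring_nf
      _ ≤ _ := by gcongr

/-- Gaussian width bound for the spherical projection of the image of a polynomial
map of degree at most `d`: with `N' = min{N, n^d}`,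
`E_g sup_{w ∈ W} ⟨g, w⟩ ≤ C·√(n·log(n·d·N'))`. -/
theorem gaussian_width_spherical_polyImage : ∃ C : ℝ, 0 < C ∧
    ∀ (n N d : ℕ), 1 ≤ n → 1 ≤ N → 2 ≤ d →
    ∀ (P : Fin N → MvPolynomial (Fin n) ℝ), (∀ i, (P i).totalDegree ≤ d) →
    (∃ x : Fin n → ℝ, polyMap P x ≠ 0) →
    (∫ g, sSup ((fun w => (inner ℝ g w : ℝ)) ''
        {w : EuclideanSpace ℝ (Fin N) |
          ∃ x : Fin n → ℝ, polyMap P x ≠ 0 ∧ w = ‖polyMap P x‖⁻¹ • polyMap P x})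
      ∂(stdGaussian (Fin N)))
      ≤ C * Real.sqrt (n * Real.log (n * d * min N (n ^ d))) := by
  refine ⟨(Real.exp 5 + 4) * √5, by positivity, fun n N d hn hN hd P hP ⟨x₀, hx₀⟩ => ?_⟩
  obtain ⟨hk, hD, hm⟩ := natCeil_mul_log_bounds hn hd rfl
  set k := ⌈(n : ℝ) * Real.log (n * d)⌉₊
  let X := {x : Fin n → ℝ // polyMap P x ≠ 0}
  have : Nonempty X := ⟨⟨x₀, hx₀⟩⟩
  let w : X → EuclideanSpace ℝ (Fin N) := fun x => ‖polyMap P x.1‖⁻¹ • polyMap P x.1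
  have hW : {w : EuclideanSpace ℝ (Fin N) |
      ∃ x : Fin n → ℝ, polyMap P x ≠ 0 ∧ w = ‖polyMap P x‖⁻¹ • polyMap P x} = Set.range w := by
    ext u
    simp [w, X, eq_comm]
  have hw (x : X) : ‖w x‖ = 1 := norm_smul_inv_norm x.2
  have hrank := finrank_span_tensorPower_le (k + 1) P hP (fun x : X => x.1)
    fun x => ‖polyMap P x.1‖⁻¹
  have hlog : Real.log (n * d) ≤ Real.log (n * d * min N (n ^ d)) := by
    have hmin : (1 : ℝ) ≤ (min N (n ^ d) : ℕ) := by
      exact_mod_cast le_min hN (Nat.one_le_pow _ _ hn)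
    have : (0 : ℝ) < n * d := by
      have : 0 < n * d := by positivity
      exact_mod_cast this
    exact Real.log_le_log this (le_mul_of_one_le_right this.le hmin)
  rw [hW]
  calc _ ≤ _ := integral_sSup_inner_le k w hw (a := Real.exp 5 * √(k + 1)) (s := √(k + 1))
        (by positivity) (by positivity)
    _ ≤ (Real.exp 5 + 4) * √(k + 1) :=
        width_bound_le_mul_sqrt hk (le_trans (by exact_mod_cast hrank) hD)
    _ ≤ (Real.exp 5 + 4) * √(5 * (n * Real.log (n * d * min N (n ^ d)))) := by
        gcongr
        exact hm.trans (by gcongr)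
    _ = _ := by
        rw [Real.sqrt_mul (by norm_num), ← mul_assoc]
end
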